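/- arXiv:2007.11873 — 4 statements merged into one kernel-verified Lean document; each statement's English description precedes it below -/
import Mathlib

section
/- For all integers r ≥ 0 and s ≥ 1, Σ_{i=0}^{r} [C(s-2+i, i) + C(s-1+i, i)] ζ₋*({1}^{r-i}, 2s+i) = Σ_{r₁+⋯+r_s = r, r_j ≥ 0} (r₁+1) ζ*(r₁+2, …, r_s+2). -/
open scoped BigOperators

/-- Alternating multiple zeta-star value ζ₋*, encoded with mᵢ = m i + 1. -/
noncomputable def zetaStarMinus {n : ℕ} (k : Fin (n + 1) → ℕ) : ℝ :=
  ∑' m : Fin (n + 1) → ℕ, if Monotone m then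
    (-1 : ℝ) ^ (m (Fin.last n)) * ∏ i, (1 : ℝ) / ((m i + 1 : ℝ) ^ (k i)) else 0

/-- Multiple zeta-star value ζ*, encoded with mᵢ = m i + 1. -/
noncomputable def zetaStar {n : ℕ} (k : Fin n → ℕ) : ℝ :=
  ∑' m : Fin n → ℕ, if Monotone m then ∏ i, (1 : ℝ) / ((m i + 1 : ℝ) ^ (k i)) else 0

open Finset PowerSeries Filter Topology

/-- The sum of `∏ i, g i (m i)` over all monotone tuples `m` with entries below `N`. -/
def monoSum {R : Type*} [CommSemiring R] {n : ℕ} (g : Fin n → ℕ → R) (N : ℕ) : R :=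
  ∑ m ∈ Fintype.piFinset (fun _ : Fin n => range N), if Monotone m then ∏ i, g i (m i) else 0

theorem monotone_snoc_iff {n : ℕ} (m : Fin n → ℕ) (k : ℕ) :
    Monotone (Fin.snoc m k : Fin (n + 1) → ℕ) ↔ Monotone m ∧ ∀ i, m i ≤ k := by
  constructor
  · intro h
    refine ⟨fun i j hij => ?_, fun i => ?_⟩
    · simpa using h (Fin.castSucc_le_castSucc_iff.2 hij)
    · simpa using h (Fin.le_last i.castSucc)
  · rintro ⟨h, hk⟩ i j hij
    induction j using Fin.lastCases with
    | last =>
      induction i using Fin.lastCases with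
      | last => exact le_rfl
      | cast i => simpa using hk i
    | cast j =>
      induction i using Fin.lastCases with
      | last => exact absurd hij (not_le.2 (Fin.castSucc_lt_last j))
      | cast i => simpa using h (Fin.castSucc_le_castSucc_iff.1 hij)

theorem monoSum_zero {R : Type*} [CommSemiring R] (g : Fin 0 → ℕ → R) (N : ℕ) :
    monoSum g N = 1 := by
  simp [monoSum, Subsingleton.monotone]

/-- Peel off the largest entry of a monotone tuple. -/
theorem monoSum_succ {R : Type*} [CommSemiring R] {n : ℕ} (g : Fin (n + 1) → ℕ → R) (N : ℕ) :
    monoSum g N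
      = ∑ k ∈ range N, g (Fin.last n) k * monoSum (fun i => g i.castSucc) (k + 1) := by
  have h1 : monoSum g N = ∑ p ∈ range N ×ˢ Fintype.piFinset (fun _ : Fin n => range N),
      if Monotone (Fin.snoc p.2 p.1 : Fin (n + 1) → ℕ) then
        ∏ i, g i ((Fin.snoc p.2 p.1 : Fin (n + 1) → ℕ) i) else 0 := by
    unfold monoSum
    symm
    refine Finset.sum_equiv (Fin.snocEquiv fun _ => ℕ) ?_ ?_
    · rintro ⟨k, m⟩
      simp [Fintype.mem_piFinset, Fin.forall_fin_succ', and_comm]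
    · rintro ⟨k, m⟩ _
      rfl
  rw [h1, Finset.sum_product]
  refine Finset.sum_congr rfl fun k hk => ?_
  rw [monoSum, Finset.mul_sum]
  symm
  refine Finset.sum_subset_zero_on_sdiff ?_ ?_ ?_
  · intro m hm
    simp only [Fintype.mem_piFinset, Finset.mem_range] at hm hk ⊢
    intro i
    have := hm i
    omega
  · intro m hm
    simp only [Finset.mem_sdiff, Fintype.mem_piFinset, Finset.mem_range, not_forall] at hm
    obtain ⟨_, i, hi⟩ := hm
    refine if_neg fun h => ?_
    have := ((monotone_snoc_iff _ _).1 h).2 i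
    simp only at this
    omega
  · intro m hm
    simp only [Fintype.mem_piFinset, Finset.mem_range] at hm
    have hk : ∀ i, m i ≤ k := fun i => Nat.lt_succ_iff.1 (hm i)
    by_cases h : Monotone m
    · rw [if_pos h, if_pos ((monotone_snoc_iff _ _).2 ⟨h, hk⟩), Fin.prod_univ_castSucc]
      simp [mul_comm]
    · rw [if_neg h, if_neg fun h' => h ((monotone_snoc_iff _ _).1 h').1, mul_zero]

theorem coeff_prod_fin {s : ℕ} (f : Fin s → ℝ⟦X⟧) (r : ℕ) :
    coeff r (∏ i, f i)
      = ∑ c ∈ Finset.Nat.antidiagonalTuple s r, ∏ i, coeff (c i) (f i) := by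
  rw [PowerSeries.coeff_prod, ← Finset.piAntidiag_univ_fin_eq_antidiagonalTuple]
  refine Finset.sum_bij (fun l _ => l) ?_ ?_ ?_ ?_
  · intro l hl
    simpa using hl
  · intro a _ b _ h
    exact DFunLike.coe_injective h
  · intro c hc
    exact ⟨Finsupp.equivFunOnFinite.symm c, by simpa using hc, by simp⟩
  · intro l hl
    rfl

/-- The expansion of `1 / (k - X)`. -/
noncomputable def linInv (k : ℕ) : ℝ⟦X⟧ := PowerSeries.mk fun c => ((k : ℝ) ^ (c + 1))⁻¹

theorem coeff_zero_mul_natCast_sub_X (f : ℝ⟦X⟧) (k : ℕ) :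
    coeff 0 (f * ((k : ℝ⟦X⟧) - X)) = coeff 0 f * k := by
  rw [← map_natCast (C (R := ℝ)), mul_sub, map_sub, coeff_mul_C, coeff_zero_mul_X, sub_zero]

theorem coeff_succ_mul_natCast_sub_X (f : ℝ⟦X⟧) (k n : ℕ) :
    coeff (n + 1) (f * ((k : ℝ⟦X⟧) - X)) = coeff (n + 1) f * k - coeff n f := by
  rw [← map_natCast (C (R := ℝ)), mul_sub, map_sub, coeff_mul_C, coeff_succ_mul_X]

theorem linInv_mul {k : ℕ} (hk : k ≠ 0) : linInv k * ((k : ℝ⟦X⟧) - X) = 1 := by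
  have : (k : ℝ) ≠ 0 := Nat.cast_ne_zero.2 hk
  ext n
  cases n with
  | zero => rw [coeff_zero_mul_natCast_sub_X]; simp [linInv, this]
  | succ n =>
    rw [coeff_succ_mul_natCast_sub_X, coeff_one, if_neg n.succ_ne_zero]
    simp only [linInv, coeff_mk]
    field_simp
    ring

/-- The expansion of `1 / (k (k - X))`. -/
noncomputable def quadInv (k : ℕ) : ℝ⟦X⟧ := PowerSeries.mk fun c => ((k : ℝ) ^ (c + 2))⁻¹

theorem quadInv_mul {k : ℕ} (hk : k ≠ 0) : quadInv k * ((k : ℝ⟦X⟧) - X) * (k : ℝ⟦X⟧) = 1 := by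
  have : (k : ℝ) ≠ 0 := Nat.cast_ne_zero.2 hk
  have h : quadInv k * (k : ℝ⟦X⟧) = linInv k := by
    ext n
    rw [← map_natCast (C (R := ℝ)), coeff_mul_C]
    simp only [linInv, quadInv, coeff_mk]
    field_simp
    ring
  rw [mul_right_comm, h, linInv_mul hk]

/-- The expansion of `1 / (k - X) ^ 2`. -/
noncomputable def sqInv (k : ℕ) : ℝ⟦X⟧ :=
  PowerSeries.mk fun c => ((c : ℝ) + 1) * ((k : ℝ) ^ (c + 2))⁻¹

theorem sqInv_mul {k : ℕ} (hk : k ≠ 0) : sqInv k * ((k : ℝ⟦X⟧) - X) ^ 2 = 1 := by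
  have : (k : ℝ) ≠ 0 := Nat.cast_ne_zero.2 hk
  have h : sqInv k * ((k : ℝ⟦X⟧) - X) = linInv k := by
    ext n
    cases n with
    | zero =>
      rw [coeff_zero_mul_natCast_sub_X]
      simp only [linInv, sqInv, coeff_mk]
      simp
      field_simp
    | succ n =>
      rw [coeff_succ_mul_natCast_sub_X]
      simp only [linInv, sqInv, coeff_mk]
      push_cast
      field_simp
      ring
  rw [pow_two, ← mul_assoc, h, linInv_mul hk]

/-- `∏ 1 / (1 - X / k)` over `1 ≤ k ≤ M`: the generating series of the complete homogeneous
symmetric polynomials of `1, 1/2, …, 1/M`. -/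
noncomputable def harmSeries : ℕ → ℝ⟦X⟧
  | 0 => 1
  | M + 1 => harmSeries M * (((M + 1 : ℕ) : ℝ⟦X⟧) * linInv (M + 1))

theorem harmSeries_succ_mul (M : ℕ) :
    harmSeries (M + 1) * (((M + 1 : ℕ) : ℝ⟦X⟧) - X) = harmSeries M * ((M + 1 : ℕ) : ℝ⟦X⟧) := by
  rw [harmSeries]
  linear_combination (harmSeries M * ((M + 1 : ℕ) : ℝ⟦X⟧)) * linInv_mul M.succ_ne_zero

theorem coeff_zero_harmSeries (M : ℕ) : coeff 0 (harmSeries M) = 1 := by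
  induction M with
  | zero => simp [harmSeries]
  | succ M ih =>
    have h := congrArg (coeff 0) (harmSeries_succ_mul M)
    rw [coeff_zero_mul_natCast_sub_X, ← map_natCast (C (R := ℝ)), coeff_mul_C, ih] at h
    exact mul_right_cancel₀ (Nat.cast_ne_zero.2 M.succ_ne_zero) h

theorem coeff_succ_harmSeries (p M : ℕ) : coeff (p + 1) (harmSeries M)
    = ∑ k ∈ range M, ((k : ℝ) + 1)⁻¹ * coeff p (harmSeries (k + 1)) := by
  induction M with
  | zero => simp [harmSeries, coeff_one]
  | succ M ih =>
    have h := congrArg (coeff (p + 1)) (harmSeries_succ_mul M)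
    rw [coeff_succ_mul_natCast_sub_X, ← map_natCast (C (R := ℝ)), coeff_mul_C, ih] at h
    rw [Finset.sum_range_succ]
    push_cast at h
    have : (M : ℝ) + 1 ≠ 0 := by positivity
    rw [← mul_left_inj' this, add_mul, ← h]
    field_simp
    ring

theorem coeff_harmSeries_eq_monoSum (p M : ℕ) :
    coeff p (harmSeries M) = monoSum (fun (_ : Fin p) k => ((k : ℝ) + 1)⁻¹) M := by
  induction p generalizing M with
  | zero => rw [coeff_zero_harmSeries, monoSum_zero]
  | succ p ih =>
    rw [coeff_succ_harmSeries, monoSum_succ]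
    exact Finset.sum_congr rfl fun k _ => by rw [ih]

/-- The expansion of `(N! / (N - m)!) / ∏ (N + j - X)`, the product over `1 ≤ j ≤ m`. -/
noncomputable def cutoff (N : ℕ) : ℕ → ℝ⟦X⟧
  | 0 => 1
  | m + 1 => cutoff N m * (((N : ℝ⟦X⟧) - (m : ℝ⟦X⟧)) * linInv (N + m + 1))

theorem cutoff_succ_mul (N m : ℕ) :
    cutoff N (m + 1) * ((N : ℝ⟦X⟧) + (m : ℝ⟦X⟧) + 1 - X) = cutoff N m * ((N : ℝ⟦X⟧) - (m : ℝ⟦X⟧)) := by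
  have h := linInv_mul (N + m).succ_ne_zero
  push_cast at h
  rw [cutoff]
  linear_combination (cutoff N m * ((N : ℝ⟦X⟧) - (m : ℝ⟦X⟧))) * h

theorem cutoff_eq_zero {N m : ℕ} (h : N < m) : cutoff N m = 0 := by
  induction m, h using Nat.le_induction with
  | base => simp [cutoff]
  | succ m _ ih => simp [cutoff, ih]

theorem natCast_sub_X_ne_zero {k : ℕ} (hk : k ≠ 0) : (k : ℝ⟦X⟧) - X ≠ 0 :=
  right_ne_zero_of_mul_eq_one (linInv_mul hk)

theorem natCast_powerSeries_ne_zero {k : ℕ} (hk : k ≠ 0) : (k : ℝ⟦X⟧) ≠ 0 :=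
  right_ne_zero_of_mul_eq_one (quadInv_mul hk)

theorem cutoff_mul (N m : ℕ) :
    cutoff N m * (((N : ℝ⟦X⟧) + 1) * ((N : ℝ⟦X⟧) + 1 - X))
      = cutoff (N + 1) m * (((N : ℝ⟦X⟧) + 1 - (m : ℝ⟦X⟧)) * ((N : ℝ⟦X⟧) + 1 + (m : ℝ⟦X⟧) - X)) := by
  induction m with
  | zero => simp [cutoff]
  | succ m ih =>
    have h1 := cutoff_succ_mul N m
    have h2 := cutoff_succ_mul (N + 1) m
    have h0 := natCast_sub_X_ne_zero (N + m).succ_ne_zero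
    push_cast at h0 h2 ⊢
    refine mul_right_cancel₀ h0 ?_
    linear_combination (((N : ℝ⟦X⟧) + 1) * ((N : ℝ⟦X⟧) + 1 - X)) * h1 + ((N : ℝ⟦X⟧) - (m : ℝ⟦X⟧)) * ih
      - ((N : ℝ⟦X⟧) - (m : ℝ⟦X⟧)) * ((N : ℝ⟦X⟧) + (m : ℝ⟦X⟧) + 1 - X) * h2

/-- The generating series of the coefficients attached to the largest summation index. -/
noncomputable def lastSeries (t m : ℕ) : ℝ⟦X⟧ := PowerSeries.mk fun i =>
  ((Nat.choose (t + i - 1) i + Nat.choose (t + i) i : ℕ) : ℝ) * ((m : ℝ) ^ (2 * (t + 1) + i))⁻¹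

theorem lastSeries_succ_mul (t : ℕ) {m : ℕ} (hm : m ≠ 0) :
    lastSeries (t + 1) m * ((m : ℝ⟦X⟧) - X) * (m : ℝ⟦X⟧) = lastSeries t m := by
  have hm' : (m : ℝ) ≠ 0 := Nat.cast_ne_zero.2 hm
  ext n
  rw [← map_natCast (C (R := ℝ)), coeff_mul_C, map_natCast]
  cases n with
  | zero =>
    rw [coeff_zero_mul_natCast_sub_X]
    simp only [lastSeries, coeff_mk]
    simp
    field_simp
    ring
  | succ n =>
    rw [coeff_succ_mul_natCast_sub_X]
    simp only [lastSeries, coeff_mk]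
    have h1 : Nat.choose (t + 1 + (n + 1) - 1) (n + 1)
        = Nat.choose (t + 1 + n - 1) n + Nat.choose (t + (n + 1) - 1) (n + 1) := by
      rw [show t + 1 + (n + 1) - 1 = (t + n) + 1 by omega, show t + 1 + n - 1 = t + n by omega,
        show t + (n + 1) - 1 = t + n by omega, Nat.choose_succ_succ]
    have h2 : Nat.choose (t + 1 + (n + 1)) (n + 1)
        = Nat.choose (t + 1 + n) n + Nat.choose (t + (n + 1)) (n + 1) := by
      rw [show t + 1 + (n + 1) = (t + n + 1) + 1 by omega, show t + 1 + n = t + n + 1 by omega,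
        show t + (n + 1) = t + n + 1 by omega, Nat.choose_succ_succ]
    rw [h1, h2]
    push_cast
    field_simp
    ring

theorem lastSeries_zero_mul {m : ℕ} (hm : m ≠ 0) :
    lastSeries 0 m * ((m : ℝ⟦X⟧) - X) * (m : ℝ⟦X⟧) * (m : ℝ⟦X⟧)
      = (m : ℝ⟦X⟧) + ((m : ℝ⟦X⟧) - X) := by
  have hm' : (m : ℝ) ≠ 0 := Nat.cast_ne_zero.2 hm
  have h : lastSeries 0 m * (m : ℝ⟦X⟧) * (m : ℝ⟦X⟧) = (m : ℝ⟦X⟧) * linInv m + 1 := by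
    ext n
    rw [← map_natCast (C (R := ℝ)), coeff_mul_C, coeff_mul_C, map_add, coeff_C_mul, coeff_one]
    simp only [lastSeries, linInv, coeff_mk]
    cases n with
    | zero =>
      simp
      field_simp
      norm_num
    | succ n =>
      simp
      field_simp
      ring
  linear_combination ((m : ℝ⟦X⟧) - X) * h + (m : ℝ⟦X⟧) * linInv_mul hm

/-- The alternating sum with cut-off at `N`. -/
noncomputable def altSum (t N : ℕ) : ℝ⟦X⟧ :=
  ∑ m ∈ range N, (-1) ^ m * (cutoff N (m + 1) * (lastSeries t (m + 1) * harmSeries (m + 1)))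

theorem altSum_diff_mul (t N : ℕ) :
    (altSum t (N + 1) - altSum t N) * ((((N + 1 : ℕ) : ℝ⟦X⟧) - X) * ((N + 1 : ℕ) : ℝ⟦X⟧))
      = ∑ m ∈ range (N + 1), (-1) ^ m * (cutoff (N + 1) (m + 1) *
          ((lastSeries t (m + 1) * (((m + 1 : ℕ) : ℝ⟦X⟧) - X) * ((m + 1 : ℕ) : ℝ⟦X⟧))
            * harmSeries (m + 1))) := by
  have h : altSum t N = ∑ m ∈ range (N + 1),
      (-1) ^ m * (cutoff N (m + 1) * (lastSeries t (m + 1) * harmSeries (m + 1))) := by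
    rw [Finset.sum_range_succ, cutoff_eq_zero N.lt_succ_self, altSum]
    simp
  rw [h, altSum, ← Finset.sum_sub_distrib, Finset.sum_mul]
  refine Finset.sum_congr rfl fun m _ => ?_
  have hc := cutoff_mul N (m + 1)
  push_cast at hc ⊢
  linear_combination (-(-1) ^ m * (lastSeries t (m + 1) * harmSeries (m + 1))) * hc

theorem sum_telescope (N M : ℕ) :
    ((N : ℝ⟦X⟧) - X) * ∑ m ∈ range M, (-1) ^ m * (cutoff N (m + 1) *
          ((lastSeries 0 (m + 1) * (((m + 1 : ℕ) : ℝ⟦X⟧) - X) * ((m + 1 : ℕ) : ℝ⟦X⟧))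
            * harmSeries (m + 1)))
      = (N : ℝ⟦X⟧) - (-1) ^ M * ((N : ℝ⟦X⟧) - (M : ℝ⟦X⟧)) * (cutoff N M * harmSeries M) := by
  induction M with
  | zero => simp [cutoff, harmSeries]
  | succ M ih =>
    rw [Finset.sum_range_succ, mul_add, ih]
    have h1 := lastSeries_zero_mul M.succ_ne_zero
    have h2 := cutoff_succ_mul N M
    have h3 := harmSeries_succ_mul M
    have h0 := natCast_powerSeries_ne_zero M.succ_ne_zero
    refine mul_right_cancel₀ h0 ?_
    push_cast at h1 h2 h3 ⊢
    linear_combination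
      ((-1) ^ M * ((N : ℝ⟦X⟧) - X) * cutoff N (M + 1) * harmSeries (M + 1)) * h1
      + (-1) ^ M * harmSeries M * ((M : ℝ⟦X⟧) + 1) * h2
      + (-1) ^ M * cutoff N (M + 1) * ((N : ℝ⟦X⟧) + (M : ℝ⟦X⟧) + 1 - X) * h3

theorem natCast_sub_X_mul_ne_zero (N : ℕ) :
    (((N + 1 : ℕ) : ℝ⟦X⟧) - X) * ((N + 1 : ℕ) : ℝ⟦X⟧) ≠ 0 :=
  mul_ne_zero (natCast_sub_X_ne_zero N.succ_ne_zero) (natCast_powerSeries_ne_zero N.succ_ne_zero)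

theorem altSum_zero_succ (N : ℕ) : altSum 0 (N + 1) = altSum 0 N + sqInv (N + 1) := by
  refine mul_right_cancel₀ (natCast_sub_X_mul_ne_zero N) ?_
  refine mul_right_cancel₀ (natCast_sub_X_ne_zero N.succ_ne_zero) ?_
  have h1 := altSum_diff_mul 0 N
  have h2 := sum_telescope (N + 1) (N + 1)
  have h3 := sqInv_mul N.succ_ne_zero
  rw [← h1, sub_self] at h2
  linear_combination h2 - ((N + 1 : ℕ) : ℝ⟦X⟧) * h3

theorem altSum_succ_succ (t N : ℕ) :
    altSum (t + 1) (N + 1) = altSum (t + 1) N + quadInv (N + 1) * altSum t (N + 1) := by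
  refine mul_right_cancel₀ (natCast_sub_X_mul_ne_zero N) ?_
  have h1 := altSum_diff_mul (t + 1) N
  have h3 := quadInv_mul N.succ_ne_zero
  have h2 : ∑ m ∈ range (N + 1), (-1) ^ m * (cutoff (N + 1) (m + 1) *
          ((lastSeries (t + 1) (m + 1) * (((m + 1 : ℕ) : ℝ⟦X⟧) - X) * ((m + 1 : ℕ) : ℝ⟦X⟧))
            * harmSeries (m + 1))) = altSum t (N + 1) :=
    Finset.sum_congr rfl fun m _ => by rw [lastSeries_succ_mul t m.succ_ne_zero]
  rw [h2] at h1
  linear_combination h1 - altSum t (N + 1) * h3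

/-- The weights of the truncated multiple zeta-star generating series. -/
noncomputable def starWeight {n : ℕ} (i : Fin n) (k : ℕ) : ℝ⟦X⟧ :=
  if (i : ℕ) = 0 then sqInv (k + 1) else quadInv (k + 1)

theorem monoSum_starWeight (t N : ℕ) :
    monoSum (starWeight : Fin (t + 1) → ℕ → ℝ⟦X⟧) N = altSum t N := by
  induction t generalizing N with
  | zero =>
    rw [monoSum_succ]
    simp only [monoSum_zero, starWeight, mul_one, Fin.val_last, if_true]
    induction N with
    | zero => simp [altSum]
    | succ N ih => rw [Finset.sum_range_succ, ih, altSum_zero_succ]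
  | succ t iht =>
    rw [monoSum_succ]
    have h (k : ℕ) : monoSum (fun i : Fin (t + 1) => starWeight i.castSucc) (k + 1)
        = altSum t (k + 1) := iht (k + 1)
    simp only [h]
    induction N with
    | zero => simp [altSum]
    | succ N ih =>
      rw [Finset.sum_range_succ, ih, altSum_succ_succ]
      simp [starWeight]

/-! ### Estimates -/

/-- The real harmonic numbers. -/
noncomputable def harmSum (M : ℕ) : ℝ := ∑ k ∈ range M, ((k : ℝ) + 1)⁻¹

theorem harmSum_nonneg (M : ℕ) : 0 ≤ harmSum M := Finset.sum_nonneg fun _ _ => by positivity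

theorem harmSum_mono : Monotone harmSum := fun _ _ h =>
  Finset.sum_le_sum_of_subset_of_nonneg (Finset.range_mono h) fun _ _ _ => by positivity

theorem one_le_harmSum_succ (M : ℕ) : 1 ≤ harmSum (M + 1) := by
  have := harmSum_mono (Nat.le_add_left 1 M)
  simpa [harmSum] using this

theorem coeff_harmSeries_nonneg (p M : ℕ) : 0 ≤ coeff p (harmSeries M) := by
  induction p generalizing M with
  | zero => simp [coeff_zero_harmSeries]
  | succ p ih =>
    rw [coeff_succ_harmSeries]
    exact Finset.sum_nonneg fun k _ => mul_nonneg (by positivity) (ih _)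

theorem coeff_harmSeries_le (p M : ℕ) : coeff p (harmSeries M) ≤ harmSum M ^ p := by
  induction p generalizing M with
  | zero => simp [coeff_zero_harmSeries]
  | succ p ih =>
    rw [coeff_succ_harmSeries, pow_succ', harmSum, Finset.sum_mul, ← harmSum]
    refine Finset.sum_le_sum fun k hk => mul_le_mul_of_nonneg_left ?_ (by positivity)
    exact (ih _).trans (pow_le_pow_left₀ (harmSum_nonneg _)
      (harmSum_mono (Finset.mem_range.1 hk)) _)

theorem abs_coeff_mul_le {f g F G : ℝ⟦X⟧} (hf : ∀ n, |coeff n f| ≤ coeff n F)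
    (hg : ∀ n, |coeff n g| ≤ coeff n G) (n : ℕ) : |coeff n (f * g)| ≤ coeff n (F * G) := by
  rw [coeff_mul, coeff_mul]
  refine (Finset.abs_sum_le_sum_abs _ _).trans (Finset.sum_le_sum fun p _ => ?_)
  rw [abs_mul]
  exact mul_le_mul (hf _) (hg _) (abs_nonneg _) ((abs_nonneg _).trans (hf _))

theorem coeff_cutoff_factor (N m n : ℕ) :
    coeff n (((N : ℝ⟦X⟧) - (m : ℝ⟦X⟧)) * linInv (N + m + 1))
      = ((N : ℝ) - m) * (((N : ℝ) + m + 1) ^ (n + 1))⁻¹ := by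
  rw [← map_natCast (C (R := ℝ)), ← map_natCast (C (R := ℝ)), ← map_sub, coeff_C_mul, linInv,
    coeff_mk]
  push_cast
  rfl

theorem abs_coeff_cutoff_le (N m n : ℕ) :
    |coeff n (cutoff N m)| ≤ coeff n (harmSeries m) := by
  induction m generalizing n with
  | zero =>
    rw [cutoff, harmSeries, coeff_one]
    split_ifs <;> simp
  | succ m ih =>
    rw [cutoff, harmSeries]
    refine abs_coeff_mul_le ih (fun j => ?_) n
    rw [coeff_cutoff_factor, ← map_natCast (C (R := ℝ)), coeff_C_mul, linInv, coeff_mk, abs_mul,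
      abs_of_nonneg (a := (((N : ℝ) + m + 1) ^ (j + 1))⁻¹) (by positivity)]
    push_cast
    have hN : (0 : ℝ) ≤ N := N.cast_nonneg
    have hm : (0 : ℝ) ≤ m := m.cast_nonneg
    have h1 : |(N : ℝ) - m| ≤ N + m + 1 := by
      rw [abs_le]; constructor <;> linarith
    have h2 : ((N : ℝ) + m + 1) * (((N : ℝ) + m + 1) ^ (j + 1))⁻¹ = (((N : ℝ) + m + 1) ^ j)⁻¹ := by
      field_simp
      ring
    have h3 : ((m : ℝ) + 1) * (((m : ℝ) + 1) ^ (j + 1))⁻¹ = (((m : ℝ) + 1) ^ j)⁻¹ := by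
      field_simp
      ring
    rw [h3]
    refine (mul_le_mul_of_nonneg_right h1 (by positivity)).trans ?_
    rw [h2]
    exact inv_anti₀ (by positivity) (pow_le_pow_left₀ (by positivity) (by linarith) _)

theorem tendsto_coeff_cutoff (m n : ℕ) :
    Tendsto (fun N => coeff n (cutoff N m)) atTop (𝓝 (coeff n (1 : ℝ⟦X⟧))) := by
  induction m generalizing n with
  | zero => exact tendsto_const_nhds
  | succ m ih =>
    have hinv : Tendsto (fun N : ℕ => ((N : ℝ) + m + 1)⁻¹) atTop (𝓝 0) := by
      have h := (tendsto_inv_atTop_nhds_zero_nat (𝕜 := ℝ)).comp (tendsto_add_atTop_nat (m + 1))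
      refine h.congr fun N => ?_
      simp [add_assoc]
    have hfac (j : ℕ) : Tendsto
        (fun N : ℕ => coeff j (((N : ℝ⟦X⟧) - (m : ℝ⟦X⟧)) * linInv (N + m + 1))) atTop
        (𝓝 (coeff j (1 : ℝ⟦X⟧))) := by
      have h1 : Tendsto (fun N : ℕ => (1 - (2 * m + 1) * ((N : ℝ) + m + 1)⁻¹)
          * (((N : ℝ) + m + 1)⁻¹) ^ j) atTop (𝓝 ((1 - (2 * m + 1) * 0) * 0 ^ j)) :=
        ((hinv.const_mul _).const_sub 1).mul (hinv.pow j)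
      have h2 : (1 - (2 * (m : ℝ) + 1) * 0) * 0 ^ j = coeff j (1 : ℝ⟦X⟧) := by
        rw [coeff_one]
        cases j <;> simp
      rw [h2] at h1
      refine h1.congr fun N => ?_
      have : (N : ℝ) + m + 1 ≠ 0 := by positivity
      rw [coeff_cutoff_factor, inv_pow]
      field_simp
      ring
    have hone : coeff n (1 : ℝ⟦X⟧) = coeff n ((1 : ℝ⟦X⟧) * 1) := by rw [mul_one]
    rw [hone]
    simp only [cutoff]
    simp only [coeff_mul _ (cutoff _ m), coeff_mul _ (1 : ℝ⟦X⟧)]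
    exact tendsto_finsetSum _ fun p _ => (ih p.1).mul (hfac p.2)

theorem summable_harmSum_pow (r : ℕ) :
    Summable fun k : ℕ => harmSum (k + 1) ^ r * (((k : ℝ) + 1) ^ 2)⁻¹ := by
  have hlog (k : ℕ) : harmSum (k + 1) ≤ 1 + Real.log ((k : ℝ) + 1) := by
    have h := harmonic_le_one_add_log (k + 1)
    simpa [harmonic, harmSum] using h
  have ho : (fun k : ℕ => (1 + Real.log ((k : ℝ) + 1)) ^ r)
      =O[atTop] fun k : ℕ => ((k : ℝ) + 1) ^ (1 / 2 : ℝ) := by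
    have hs : Tendsto (fun k : ℕ => (k : ℝ) + 1) atTop atTop :=
      tendsto_atTop_add_const_right _ _ tendsto_natCast_atTop_atTop
    have h1 : (fun x : ℝ => (1 + Real.log x) ^ r) =O[atTop] fun x : ℝ => Real.log x ^ r := by
      refine Asymptotics.IsBigO.pow ?_ r
      refine Asymptotics.IsBigO.add ?_ (Asymptotics.isBigO_refl _ _)
      exact (Real.isLittleO_const_log_atTop (c := 1)).isBigO
    have h2 : (fun x : ℝ => Real.log x ^ r) =O[atTop] fun x : ℝ => x ^ (1 / 2 : ℝ) := by
      have := (isLittleO_log_rpow_rpow_atTop (s := 1 / 2) (r : ℝ) (by norm_num)).isBigO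
      simpa only [Real.rpow_natCast] using this
    exact (h1.trans h2).comp_tendsto hs
  have hsum : Summable fun k : ℕ => ((k : ℝ) + 1) ^ (1 / 2 : ℝ) * (((k : ℝ) + 1) ^ 2)⁻¹ := by
    have h := (summable_nat_add_iff 1).2
      (Real.summable_nat_rpow_inv.2 (show (1 : ℝ) < 3 / 2 by norm_num))
    refine h.congr fun k => ?_
    have hk : (0 : ℝ) < (k : ℝ) + 1 := by positivity
    push_cast
    rw [← Real.rpow_natCast, ← Real.rpow_neg hk.le, ← Real.rpow_neg hk.le, ← Real.rpow_add hk]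
    norm_num
  have hsum' : Summable fun k : ℕ => (1 + Real.log ((k : ℝ) + 1)) ^ r * (((k : ℝ) + 1) ^ 2)⁻¹ :=
    summable_of_isBigO_nat hsum (ho.mul (Asymptotics.isBigO_refl _ _))
  refine hsum'.of_nonneg_of_le (fun k => ?_) fun k => ?_
  · exact mul_nonneg (pow_nonneg (harmSum_nonneg _) _) (by positivity)
  · exact mul_le_mul_of_nonneg_right (pow_le_pow_left₀ (harmSum_nonneg _) (hlog k) _)
      (by positivity)

theorem coeff_lastSeries_nonneg (t m n : ℕ) : 0 ≤ coeff n (lastSeries t m) := by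
  rw [lastSeries, coeff_mk]
  positivity

theorem coeff_lastSeries_succ_le (t m n : ℕ) : coeff n (lastSeries t (m + 1))
    ≤ ((Nat.choose (t + n - 1) n + Nat.choose (t + n) n : ℕ) : ℝ) * (((m : ℝ) + 1) ^ 2)⁻¹ := by
  rw [lastSeries, coeff_mk]
  refine mul_le_mul_of_nonneg_left (inv_anti₀ (by positivity) ?_) (Nat.cast_nonneg _)
  push_cast
  exact pow_le_pow_right₀ (by linarith [(m.cast_nonneg : (0 : ℝ) ≤ m)]) (by omega)

/-- A bound for the `r`-th coefficient, uniform in `N`, that decays almost like `1 / (m + 1) ^ 2`. -/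
theorem exists_coeff_bound (t r : ℕ) : ∃ c : ℝ, ∀ N m : ℕ,
    |coeff r (cutoff N (m + 1) * (lastSeries t (m + 1) * harmSeries (m + 1)))|
      ≤ c * (harmSum (m + 1) ^ r * (((m : ℝ) + 1) ^ 2)⁻¹) := by
  refine ⟨∑ p ∈ antidiagonal r, ∑ q ∈ antidiagonal p.2,
    ((Nat.choose (t + q.1 - 1) q.1 + Nat.choose (t + q.1) q.1 : ℕ) : ℝ), fun N m => ?_⟩
  have hH := one_le_harmSum_succ m
  have hH0 := harmSum_nonneg (m + 1)
  have h1 : |coeff r (cutoff N (m + 1) * (lastSeries t (m + 1) * harmSeries (m + 1)))|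
      ≤ coeff r (harmSeries (m + 1) * (lastSeries t (m + 1) * harmSeries (m + 1))) := by
    refine abs_coeff_mul_le (abs_coeff_cutoff_le N (m + 1)) (abs_coeff_mul_le ?_ ?_) r
    · exact fun n => (abs_of_nonneg (coeff_lastSeries_nonneg _ _ _)).le
    · exact fun n => (abs_of_nonneg (coeff_harmSeries_nonneg _ _)).le
  refine h1.trans ?_
  rw [coeff_mul, Finset.sum_mul]
  refine Finset.sum_le_sum fun p hp => ?_
  rw [coeff_mul, Finset.mul_sum, Finset.sum_mul]
  refine Finset.sum_le_sum fun q hq => ?_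
  rw [Finset.HasAntidiagonal.mem_antidiagonal] at hp hq
  have hpow : harmSum (m + 1) ^ p.1 * harmSum (m + 1) ^ q.2 ≤ harmSum (m + 1) ^ r := by
    rw [← pow_add]
    exact pow_le_pow_right₀ hH (by omega)
  have h2 := coeff_lastSeries_succ_le t m q.1
  have h3 := mul_le_mul (coeff_harmSeries_le p.1 (m + 1)) (coeff_harmSeries_le q.2 (m + 1))
    (coeff_harmSeries_nonneg _ _) (pow_nonneg hH0 _)
  have h4 := mul_le_mul (h3.trans hpow) h2 (coeff_lastSeries_nonneg _ _ _) (pow_nonneg hH0 _)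
  calc _ = _ := by ring
    _ ≤ _ := h4
    _ = _ := by ring

/-! ### Passage to the limit -/

theorem tendsto_sum_box {n : ℕ} {f : (Fin n → ℕ) → ℝ} {c : ℝ}
    (h : ∀ N, ∑ m ∈ Fintype.piFinset (fun _ : Fin n => range N), |f m| ≤ c) :
    Tendsto (fun N => ∑ m ∈ Fintype.piFinset (fun _ : Fin n => range N), f m) atTop
      (𝓝 (∑' m, f m)) := by
  have hmem (m : Fin n → ℕ) : m ∈ Fintype.piFinset (fun _ : Fin n => range (∑ i, m i + 1)) := by
    rw [Fintype.mem_piFinset]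
    intro i
    exact Finset.mem_range.2
      (Nat.lt_succ_of_le (Finset.single_le_sum (fun _ _ => Nat.zero_le _) (Finset.mem_univ i)))
  have hmono : Monotone fun N => Fintype.piFinset (fun _ : Fin n => range N) := fun _ _ hab =>
    Fintype.piFinset_subset _ _ fun _ => Finset.range_mono hab
  have htop := tendsto_atTop_finset_of_monotone hmono fun m => ⟨_, hmem m⟩
  have hs : Summable fun m => |f m| := by
    refine summable_of_sum_le (c := c) (fun _ => abs_nonneg _) fun u => ?_
    obtain ⟨N, hN⟩ := (htop.eventually_ge_atTop u).exists
    exact (Finset.sum_le_sum_of_subset_of_nonneg hN fun _ _ _ => abs_nonneg _).trans (h N)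
  exact hs.of_abs.hasSum.comp htop

theorem tendsto_monoSum {n : ℕ} {g : Fin n → ℕ → ℝ} {c : ℝ}
    (h : ∀ N, monoSum (fun i k => |g i k|) N ≤ c) :
    Tendsto (fun N => monoSum g N) atTop
      (𝓝 (∑' m : Fin n → ℕ, if Monotone m then ∏ i, g i (m i) else 0)) := by
  refine tendsto_sum_box (c := c) fun N => ?_
  refine le_of_eq_of_le (Finset.sum_congr rfl fun m _ => ?_) (h N)
  split_ifs
  · rw [Finset.abs_prod]
  · exact abs_zero

theorem tendsto_zetaStarMinus (p : ℕ) {q : ℕ} (hq : 2 ≤ q) :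
    Tendsto (fun N => ∑ k ∈ range N,
        (-1) ^ k * (((k : ℝ) + 1) ^ q)⁻¹ * coeff p (harmSeries (k + 1))) atTop
      (𝓝 (zetaStarMinus fun j : Fin (p + 1) => if j = Fin.last p then q else 1)) := by
  let g : Fin (p + 1) → ℕ → ℝ := fun i k =>
    if i = Fin.last p then (-1) ^ k * (((k : ℝ) + 1) ^ q)⁻¹ else ((k : ℝ) + 1)⁻¹
  have hne (i : Fin p) : i.castSucc ≠ Fin.last p := (Fin.castSucc_lt_last i).ne
  have hg : ∀ N, monoSum g N = ∑ k ∈ range N,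
      (-1) ^ k * (((k : ℝ) + 1) ^ q)⁻¹ * coeff p (harmSeries (k + 1)) := fun N => by
    simp [monoSum_succ, g, coeff_harmSeries_eq_monoSum, hne]
  have hz : zetaStarMinus (fun j : Fin (p + 1) => if j = Fin.last p then q else 1)
      = ∑' m : Fin (p + 1) → ℕ, if Monotone m then ∏ i, g i (m i) else 0 := by
    unfold zetaStarMinus
    congr 1
    ext m
    congr 1
    simp only [Fin.prod_univ_castSucc, g, hne, if_true, if_false, pow_one, one_div]
    ring
  simp only [← hg]
  rw [hz]
  refine tendsto_monoSum
    (c := ∑' k : ℕ, harmSum (k + 1) ^ p * (((k : ℝ) + 1) ^ 2)⁻¹) fun N => ?_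
  have habs : monoSum (fun i k => |g i k|) N
      = ∑ k ∈ range N, coeff p (harmSeries (k + 1)) * (((k : ℝ) + 1) ^ q)⁻¹ := by
    rw [monoSum_succ]
    refine Finset.sum_congr rfl fun k _ => ?_
    have h1 (i : Fin p) (j : ℕ) : |g i.castSucc j| = ((j : ℝ) + 1)⁻¹ := by
      simp only [g, hne, if_false]
      exact abs_of_nonneg (by positivity)
    have h2 : |g (Fin.last p) k| = (((k : ℝ) + 1) ^ q)⁻¹ := by
      simp only [g, if_true, abs_mul, abs_pow, abs_neg, abs_one, one_pow, one_mul]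
      exact abs_of_nonneg (by positivity)
    simp only [h1, h2, coeff_harmSeries_eq_monoSum]
    ring
  rw [habs]
  refine le_trans (Finset.sum_le_sum fun k _ => ?_) ((summable_harmSum_pow p).sum_le_tsum (range N)
    fun k _ => mul_nonneg (pow_nonneg (harmSum_nonneg _) _) (by positivity))
  refine mul_le_mul (coeff_harmSeries_le _ _) (inv_anti₀ (by positivity) ?_) (by positivity)
    (pow_nonneg (harmSum_nonneg _) _)
  exact pow_le_pow_right₀ (by linarith [(k.cast_nonneg : (0 : ℝ) ≤ k)]) hq

theorem monoSum_inv_pow_bound {n : ℕ} (c : Fin n → ℕ) (N : ℕ) :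
    0 ≤ monoSum (fun i k => (((k : ℝ) + 1) ^ (c i + 2))⁻¹) N ∧
    monoSum (fun i k => (((k : ℝ) + 1) ^ (c i + 2))⁻¹) N
      ≤ (∑' k : ℕ, harmSum (k + 1) ^ 0 * (((k : ℝ) + 1) ^ 2)⁻¹) ^ n := by
  induction n generalizing N with
  | zero => simp [monoSum_zero]
  | succ n ih =>
    rw [monoSum_succ, pow_succ']
    have h0 (k : ℕ) : (0 : ℝ) ≤ harmSum (k + 1) ^ 0 * (((k : ℝ) + 1) ^ 2)⁻¹ := by
      rw [pow_zero, one_mul]; positivity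
    have hZ : 0 ≤ ∑' k : ℕ, harmSum (k + 1) ^ 0 * (((k : ℝ) + 1) ^ 2)⁻¹ := tsum_nonneg h0
    refine ⟨Finset.sum_nonneg fun k _ => mul_nonneg (by positivity) (ih _ _).1, ?_⟩
    refine le_trans ?_ (mul_le_mul_of_nonneg_right
      ((summable_harmSum_pow 0).sum_le_tsum (range N) fun k _ => h0 k) (pow_nonneg hZ n))
    rw [Finset.sum_mul]
    refine Finset.sum_le_sum fun k _ => ?_
    refine mul_le_mul ?_ (ih _ _).2 (ih _ _).1 (h0 k)
    rw [pow_zero, one_mul]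
    refine inv_anti₀ (by positivity) ?_
    exact pow_le_pow_right₀ (by linarith [(k.cast_nonneg : (0 : ℝ) ≤ k)]) (by omega)

theorem tendsto_zetaStar {n : ℕ} (c : Fin n → ℕ) :
    Tendsto (fun N => monoSum (fun i k => (((k : ℝ) + 1) ^ (c i + 2))⁻¹) N) atTop
      (𝓝 (zetaStar fun j => c j + 2)) := by
  have hz : zetaStar (fun j => c j + 2) = ∑' m : Fin n → ℕ, if Monotone m then
      ∏ i, (((m i : ℝ) + 1) ^ (c i + 2))⁻¹ else 0 := by
    simp only [zetaStar, one_div]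
  rw [hz]
  refine tendsto_monoSum (g := fun i k => (((k : ℝ) + 1) ^ (c i + 2))⁻¹)
    (c := (∑' k : ℕ, harmSum (k + 1) ^ 0 * (((k : ℝ) + 1) ^ 2)⁻¹) ^ n) fun N => ?_
  have habs (i : Fin n) (k : ℕ) :
      |(((k : ℝ) + 1) ^ (c i + 2))⁻¹| = (((k : ℝ) + 1) ^ (c i + 2))⁻¹ :=
    abs_of_nonneg (by positivity)
  simp only [habs]
  exact (monoSum_inv_pow_bound c N).2

theorem coeff_monoSum_starWeight (t r N : ℕ) :
    coeff r (monoSum (starWeight : Fin (t + 1) → ℕ → ℝ⟦X⟧) N)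
      = ∑ c ∈ Finset.Nat.antidiagonalTuple (t + 1) r, ((c 0 : ℝ) + 1)
          * monoSum (fun i k => (((k : ℝ) + 1) ^ (c i + 2))⁻¹) N := by
  simp only [monoSum, map_sum, Finset.mul_sum]
  rw [Finset.sum_comm]
  refine Finset.sum_congr rfl fun m _ => ?_
  split_ifs
  · rw [coeff_prod_fin]
    refine Finset.sum_congr rfl fun c _ => ?_
    rw [Fin.prod_univ_succ, Fin.prod_univ_succ]
    simp [starWeight, sqInv, quadInv, mul_assoc]
  · simp

theorem coeff_neg_one_pow_mul (r k : ℕ) (f : ℝ⟦X⟧) :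
    coeff r ((-1) ^ k * f) = (-1) ^ k * coeff r f := by
  rcases Nat.even_or_odd k with h | h <;> simp [h.neg_one_pow]

theorem tendsto_coeff_cutoff_mul (r m : ℕ) (f : ℝ⟦X⟧) :
    Tendsto (fun N => coeff r (cutoff N m * f)) atTop (𝓝 (coeff r f)) := by
  have hone : coeff r f = coeff r (1 * f) := by rw [one_mul]
  rw [hone]
  simp only [coeff_mul]
  exact tendsto_finsetSum _ fun p _ => (tendsto_coeff_cutoff _ _).mul_const _

theorem tendsto_coeff_altSum (t r : ℕ) :
    Tendsto (fun N => coeff r (altSum t N)) atTop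
      (𝓝 (∑' k : ℕ, (-1) ^ k * coeff r (lastSeries t (k + 1) * harmSeries (k + 1)))) := by
  obtain ⟨c, hc⟩ := exists_coeff_bound t r
  have hfin (N : ℕ) : coeff r (altSum t N) = ∑' k : ℕ, (-1) ^ k *
      coeff r (cutoff N (k + 1) * (lastSeries t (k + 1) * harmSeries (k + 1))) := by
    rw [tsum_eq_sum (s := range N), altSum, map_sum]
    · exact Finset.sum_congr rfl fun k _ => coeff_neg_one_pow_mul _ _ _
    · intro k hk
      rw [Finset.mem_range, not_lt] at hk
      rw [cutoff_eq_zero (Nat.lt_succ_of_le hk)]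
      simp
  simp only [hfin]
  refine tendsto_tsum_of_dominated_convergence ((summable_harmSum_pow r).mul_left c) (fun k => ?_)
    (Eventually.of_forall fun N k => ?_)
  · exact (tendsto_coeff_cutoff_mul r (k + 1) _).const_mul _
  · rw [Real.norm_eq_abs, abs_mul, abs_pow, abs_neg, abs_one, one_pow, one_mul]
    exact hc N k

theorem summable_coeff_lastSeries_mul (t r : ℕ) :
    Summable fun k : ℕ => (-1 : ℝ) ^ k * coeff r (lastSeries t (k + 1) * harmSeries (k + 1)) := by
  obtain ⟨c, hc⟩ := exists_coeff_bound t r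
  refine ((summable_harmSum_pow r).mul_left c).of_norm_bounded fun k => ?_
  rw [Real.norm_eq_abs, abs_mul, abs_pow, abs_neg, abs_one, one_pow, one_mul]
  exact le_of_tendsto (tendsto_coeff_cutoff_mul r (k + 1) _).abs
    (Eventually.of_forall fun N => hc N k)

theorem stmt5 (r s : ℕ) (hs : 1 ≤ s) :
    (∑ i ∈ Finset.range (r + 1),
      ((Nat.choose (s + i - 2) i + Nat.choose (s + i - 1) i : ℕ) : ℝ)
        * zetaStarMinus (fun j : Fin (r - i + 1) => if j = Fin.last (r - i) then 2 * s + i else 1))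
    = ∑ c ∈ Finset.Nat.antidiagonalTuple s r,
        ((c ⟨0, hs⟩ : ℝ) + 1) * zetaStar (fun j : Fin s => c j + 2) := by
  obtain ⟨t, rfl⟩ : ∃ t, s = t + 1 := ⟨s - 1, by omega⟩
  have hright : Tendsto (fun N => coeff r (altSum t N)) atTop
      (𝓝 (∑ c ∈ Finset.Nat.antidiagonalTuple (t + 1) r,
        ((c 0 : ℝ) + 1) * zetaStar (fun j : Fin (t + 1) => c j + 2))) := by
    simp only [← monoSum_starWeight, coeff_monoSum_starWeight]
    exact tendsto_finsetSum _ fun c _ => (tendsto_zetaStar c).const_mul _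
  have hleft := tendsto_finsetSum (range (r + 1)) fun i (_ : i ∈ range (r + 1)) =>
    (tendsto_zetaStarMinus (r - i) (q := 2 * (t + 1) + i) (by omega)).const_mul
      ((Nat.choose (t + 1 + i - 2) i + Nat.choose (t + 1 + i - 1) i : ℕ) : ℝ)
  have hpartial (N : ℕ) : ∑ i ∈ range (r + 1),
      ((Nat.choose (t + 1 + i - 2) i + Nat.choose (t + 1 + i - 1) i : ℕ) : ℝ) *
        ∑ k ∈ range N, (-1) ^ k * (((k : ℝ) + 1) ^ (2 * (t + 1) + i))⁻¹
          * coeff (r - i) (harmSeries (k + 1))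
      = ∑ k ∈ range N, (-1) ^ k * coeff r (lastSeries t (k + 1) * harmSeries (k + 1)) := by
    simp only [Finset.mul_sum]
    rw [Finset.sum_comm]
    refine Finset.sum_congr rfl fun k _ => ?_
    rw [coeff_mul, Finset.Nat.sum_antidiagonal_eq_sum_range_succ_mk, Finset.mul_sum]
    refine Finset.sum_congr rfl fun i _ => ?_
    rw [show t + 1 + i - 2 = t + i - 1 by omega, show t + 1 + i - 1 = t + i by omega]
    simp only [lastSeries, coeff_mk]
    push_cast
    ring
  simp only [hpartial] at hleft
  rw [tendsto_nhds_unique hleft (summable_coeff_lastSeries_mul t r).hasSum.tendsto_sum_nat]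
  exact tendsto_nhds_unique (tendsto_coeff_altSum t r) hright
end

section
/- For s ≥ 1 and complex α with s + 1/2 > Re(α) > 1/2, the identity 2 Σ_{m≥0} [(2α-1)_{m+1}/m!] (-1)^m/(m+α)^{2s+1} = [Γ(α)²/Γ(2α-1)] Σ_{0≤m₁≤⋯≤m_s<∞} Π_{i=1}^s 1/(mᵢ+α)² holds, where (a)_n is the Pochhammer symbol. -/
open scoped BigOperators

namespace StarSum

open Finset Filter Topology

/-! ### Complete homogeneous sums over weakly increasing tuples -/

/-- Weakly increasing `s`-tuples with entries in `{0, …, N}`. -/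
noncomputable def monoTuples (s N : ℕ) : Finset (Fin s → ℕ) := by
  classical exact (Fintype.piFinset fun _ => range (N + 1)).filter Monotone

lemma mem_monoTuples {s N : ℕ} {m : Fin s → ℕ} :
    m ∈ monoTuples s N ↔ (∀ i, m i ≤ N) ∧ Monotone m := by
  simp [monoTuples]

lemma monotone_snoc_iff {s : ℕ} (m : Fin s → ℕ) (k : ℕ) :
    Monotone (Fin.snoc m k : Fin (s + 1) → ℕ) ↔ (∀ i, m i ≤ k) ∧ Monotone m := by
  constructor
  · intro h
    refine ⟨fun i => ?_, fun i j hij => ?_⟩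
    · simpa using h (Fin.le_last i.castSucc)
    · simpa using h (Fin.castSucc_le_castSucc_iff.mpr hij)
  · rintro ⟨hk, hm⟩ i j hij
    induction j using Fin.lastCases with
    | last =>
      induction i using Fin.lastCases with
      | last => rfl
      | cast i => simpa using hk i
    | cast j =>
      induction i using Fin.lastCases with
      | last => exact absurd hij (not_le.mpr (Fin.castSucc_lt_last j))
      | cast i => simpa using hm (Fin.castSucc_le_castSucc_iff.mp hij)

/-- The sum of `∏ x (m i)` over weakly increasing `s`-tuples with entries at most `N`. -/
noncomputable def starSum {K : Type*} [Field K] (x : ℕ → K) (s N : ℕ) : K :=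
  ∑ m ∈ monoTuples s N, ∏ i, x (m i)

lemma starSum_zero {K : Type*} [Field K] (x : ℕ → K) (N : ℕ) : starSum x 0 N = 1 := by
  have h : monoTuples 0 N = {Fin.elim0} := by
    ext m
    simp only [mem_monoTuples, mem_singleton]
    exact ⟨fun _ => Subsingleton.elim _ _, fun _ => ⟨fun i => i.elim0, fun i => i.elim0⟩⟩
  simp [starSum, h]

lemma starSum_succ {K : Type*} [Field K] (x : ℕ → K) (s N : ℕ) :
    starSum x (s + 1) N = ∑ k ∈ range (N + 1), x k * starSum x s k := by
  simp only [starSum, mul_sum]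
  rw [sum_sigma']
  symm
  refine sum_nbij' (fun p => Fin.snoc p.2 p.1)
    (fun m => ⟨m (Fin.last s), fun i => m i.castSucc⟩) ?_ ?_ ?_ ?_ ?_
  · rintro ⟨k, m⟩ h
    simp only [mem_sigma, mem_range, mem_monoTuples, Nat.lt_succ_iff] at h ⊢
    refine ⟨fun i => ?_, (monotone_snoc_iff m k).mpr h.2⟩
    induction i using Fin.lastCases with
    | last => simpa using h.1
    | cast i => simpa using (h.2.1 i).trans h.1
  · intro m h
    simp only [mem_sigma, mem_range, mem_monoTuples, Nat.lt_succ_iff] at h ⊢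
    exact ⟨h.1 _, fun i => h.2 (Fin.le_last _),
      fun i j hij => h.2 (Fin.castSucc_le_castSucc_iff.mpr hij)⟩
  · rintro ⟨k, m⟩ _
    simp
  · intro m _
    ext i
    induction i using Fin.lastCases with
    | last => simp
    | cast i => simp
  · rintro ⟨k, m⟩ _
    simp [Fin.prod_univ_castSucc, mul_comm]

/-- Value at `0` of the Lagrange basis polynomial of the nodes `v 0, …, v N`. -/
noncomputable def lagrangeWeight {K : Type*} [Field K] (v : ℕ → K) (N m : ℕ) : K :=
  ∏ j ∈ (range (N + 1)).erase m, v j / (v j - v m)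

lemma sum_lagrangeWeight {K : Type*} [Field K] {v : ℕ → K} (hv : Function.Injective v) (N : ℕ) :
    ∑ m ∈ range (N + 1), lagrangeWeight v N m = 1 := by
  have h := congrArg (Polynomial.eval 0)
    (Lagrange.sum_basis (s := range (N + 1)) (v := v) hv.injOn ⟨0, by simp⟩)
  rw [Polynomial.eval_finsetSum, Polynomial.eval_one] at h
  rw [← h]
  refine sum_congr rfl fun m _ => ?_
  rw [lagrangeWeight, Lagrange.basis, Polynomial.eval_prod]
  refine prod_congr rfl fun j hj => ?_
  have hjm : v j - v m ≠ 0 := sub_ne_zero.mpr fun h => (mem_erase.mp hj).1 (hv h)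
  have hmj : v m - v j ≠ 0 := by rw [← neg_sub]; exact neg_ne_zero.mpr hjm
  simp only [Lagrange.basisDivisor, Polynomial.eval_mul, Polynomial.eval_C, Polynomial.eval_sub,
    Polynomial.eval_X]
  field_simp
  ring

lemma lagrangeWeight_succ {K : Type*} [Field K] (v : ℕ → K) {N m : ℕ} (hm : m ≤ N) :
    lagrangeWeight v (N + 1) m =
      v (N + 1) / (v (N + 1) - v m) * lagrangeWeight v N m := by
  rw [lagrangeWeight, range_add_one, erase_insert_of_ne (by omega), prod_insert (by simp)]
  rfl

/-- Partial fraction formula for complete homogeneous symmetric sums. -/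
lemma starSum_eq_sum_lagrangeWeight {K : Type*} [Field K] {v : ℕ → K}
    (hv : Function.Injective v) (h0 : ∀ n, v n ≠ 0) (s N : ℕ) :
    starSum (fun n => (v n)⁻¹) s N =
      ∑ m ∈ range (N + 1), ((v m)⁻¹) ^ s * lagrangeWeight v N m := by
  induction s generalizing N with
  | zero => simp [starSum_zero, sum_lagrangeWeight hv]
  | succ s ih =>
    rw [starSum_succ]
    induction N with
    | zero => simp [ih, pow_succ, lagrangeWeight, mul_comm]
    | succ N ihN =>
      rw [sum_range_succ, ihN, ih, sum_range_succ _ (N + 1), sum_range_succ _ (N + 1), mul_add,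
        mul_sum, ← add_assoc, ← sum_add_distrib]
      congr 1
      · refine sum_congr rfl fun m hm => ?_
        have hmN : m ≤ N := Nat.lt_succ_iff.mp (mem_range.mp hm)
        have hd : v (N + 1) - v m ≠ 0 := sub_ne_zero.mpr fun h => by
          have := hv h
          omega
        rw [lagrangeWeight_succ v hmN]
        have := h0 m
        have := h0 (N + 1)
        rw [pow_succ]
        field_simp
        ring
      · ring

/-! ### The nodes `(n + α) ^ 2` -/

/-- The Pochhammer symbol as an explicit product. -/
noncomputable def poch (a : ℂ) (n : ℕ) : ℂ := ∏ j ∈ range n, (a + j)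

lemma ascPochhammer_eval (a : ℂ) (n : ℕ) : (ascPochhammer ℂ n).eval a = poch a n := by
  induction n with
  | zero => simp [poch]
  | succ n ih => rw [ascPochhammer_succ_eval, ih, poch, poch, prod_range_succ]

lemma poch_succ (a : ℂ) (n : ℕ) : poch a (n + 1) = poch a n * (a + n) := prod_range_succ _ _

lemma poch_add (a : ℂ) (n k : ℕ) :
    poch a (n + k) = poch a n * ∏ j ∈ range k, (a + n + j) := by
  rw [poch, prod_range_add]
  simp [poch, add_assoc]

lemma add_natCast_ne_zero {a : ℂ} (ha : 0 < a.re) (n : ℕ) : a + n ≠ 0 := by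
  intro h
  have h' := congrArg Complex.re h
  simp only [Complex.add_re, Complex.natCast_re, Complex.zero_re] at h'
  have : (0 : ℝ) ≤ n := n.cast_nonneg
  linarith

lemma poch_ne_zero {a : ℂ} (ha : 0 < a.re) (n : ℕ) : poch a n ≠ 0 :=
  prod_ne_zero_iff.mpr fun j _ => add_natCast_ne_zero ha j

lemma sq_sub_sq_ne_zero {α : ℂ} (hα : 0 < α.re) {j m : ℕ} (h : j ≠ m) :
    ((j : ℂ) + α) ^ 2 - ((m : ℂ) + α) ^ 2 ≠ 0 := by
  have h1 : ((j : ℂ) - m) ≠ 0 := sub_ne_zero.mpr (by exact_mod_cast h)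
  have h2 : 2 * α + ((j + m : ℕ) : ℂ) ≠ 0 :=
    add_natCast_ne_zero (by simpa using hα) _
  have h3 : ((j : ℂ) + α) ^ 2 - ((m : ℂ) + α) ^ 2 = (j - m) * (2 * α + ((j + m : ℕ) : ℂ)) := by
    push_cast
    ring
  rw [h3]
  exact mul_ne_zero h1 h2

lemma injective_sq {α : ℂ} (hα : 0 < α.re) :
    Function.Injective fun n : ℕ => ((n : ℂ) + α) ^ 2 := by
  intro j m h
  by_contra hne
  exact sq_sub_sq_ne_zero hα hne (sub_eq_zero.mpr h)

lemma prod_range_natCast_sub (m : ℕ) :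
    ∏ j ∈ range m, ((j : ℂ) - m) = (-1) ^ m * m.factorial := by
  rw [← prod_range_reflect, ← prod_range_add_one_eq_factorial, Nat.cast_prod,
    ← card_range m, ← prod_const, card_range, ← prod_mul_distrib]
  refine prod_congr rfl fun j hj => ?_
  have : j < m := mem_range.mp hj
  rw [Nat.sub_sub, Nat.cast_sub (by omega)]
  push_cast
  ring

lemma lagrangeWeight_sq {α : ℂ} (hα : 1 / 2 < α.re) (m d : ℕ) :
    lagrangeWeight (fun n : ℕ => ((n : ℂ) + α) ^ 2) (m + d) m =
      2 * (poch (2 * α - 1) (m + 1) / m.factorial * ((-1) ^ m / ((m : ℂ) + α))) *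
        (poch α (m + d + 1) ^ 2 / (d.factorial * poch (2 * α - 1) (m + d + 2 + m))) := by
  have hα0 : 0 < α.re := by linarith
  have hβ : 0 < (2 * α - 1).re := by simp; linarith
  induction d with
  | zero =>
    have hmα : (m : ℂ) + α ≠ 0 := by rw [add_comm]; exact add_natCast_ne_zero hα0 m
    have hm : (m.factorial : ℂ) ≠ 0 := by exact_mod_cast m.factorial_ne_zero
    have hprod : ∏ j ∈ range m, (2 * α - 1 + (m + 1 : ℕ) + j) ≠ 0 :=
      prod_ne_zero_iff.mpr fun j _ => by
        rw [add_assoc, ← Nat.cast_add]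
        exact add_natCast_ne_zero hβ _
    have hlast : 2 * α - 1 + (m + 1 + m : ℕ) = 2 * ((m : ℂ) + α) := by
      push_cast
      ring
    have hp := poch_ne_zero hβ (m + 1)
    have hfactor : ∏ j ∈ range m, (((j : ℂ) + α) ^ 2 - ((m : ℂ) + α) ^ 2) =
        ∏ j ∈ range m, (((j : ℂ) - m) * (2 * α - 1 + (m + 1 : ℕ) + j)) :=
      prod_congr rfl fun j _ => by push_cast; ring
    rw [lagrangeWeight, add_zero, range_add_one, erase_insert (by simp), prod_div_distrib,
      hfactor, prod_mul_distrib, prod_range_natCast_sub, prod_pow,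
      show m + 2 + m = m + 1 + m + 1 by ring, poch_succ _ (m + 1 + m), poch_add _ (m + 1) m, hlast,
      poch_succ α m, prod_congr rfl (g := fun j : ℕ => α + j) (fun j _ => add_comm _ _)]
    change poch α m ^ 2 / _ = _
    rw [add_comm α]
    have hs : ((-1 : ℂ) ^ m) * (-1) ^ m = 1 := by rw [← mul_pow]; simp
    have hs0 : ((-1 : ℂ) ^ m) ≠ 0 := left_ne_zero_of_mul_eq_one hs
    simp only [Nat.factorial_zero, Nat.cast_one, one_mul]
    field_simp
    rw [pow_two ((-1 : ℂ) ^ m), hs]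
    ring
  | succ d ih =>
    rw [← add_assoc, lagrangeWeight_succ _ (by omega), ih,
      show m + d + 1 + 2 + m = m + d + 2 + m + 1 by ring, poch_succ _ (m + d + 2 + m),
      poch_succ α (m + d + 1), Nat.factorial_succ]
    have e : ((m + d + 1 : ℕ) + α) ^ 2 - ((m : ℂ) + α) ^ 2 =
        ((d + 1 : ℕ) : ℂ) * (2 * α - 1 + (m + d + 2 + m : ℕ)) := by
      push_cast
      ring
    have h1 : ((d + 1 : ℕ) : ℂ) ≠ 0 := by exact_mod_cast d.succ_ne_zero
    have h2 := add_natCast_ne_zero hβ (m + d + 2 + m)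
    have h3 := poch_ne_zero hβ (m + d + 2 + m)
    have h4 : (d.factorial : ℂ) ≠ 0 := by exact_mod_cast d.factorial_ne_zero
    have hmα : (m : ℂ) + α ≠ 0 := by rw [add_comm]; exact add_natCast_ne_zero hα0 m
    have hm : (m.factorial : ℂ) ≠ 0 := by exact_mod_cast m.factorial_ne_zero
    simp only [e]
    rw [Nat.cast_mul]
    field_simp
    ring

/-- The ratio by which the `m`-th term of the truncated sum differs from the `0`-th one. -/
noncomputable def dampingRatio (α : ℂ) (N m : ℕ) : ℂ :=
  ∏ k ∈ range m, ((N : ℂ) - k) / (2 * α - 1 + (N + 2 : ℕ) + k)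

lemma dampingRatio_eq_zero {α : ℂ} {N m : ℕ} (h : N < m) : dampingRatio α N m = 0 :=
  prod_eq_zero (mem_range.mpr h) (by simp)

lemma prod_range_natCast_rev (m d : ℕ) :
    (d.factorial : ℂ) * ∏ k ∈ range m, (((m + d : ℕ) : ℂ) - k) = (m + d).factorial := by
  have h := Nat.factorial_mul_descFactorial (n := m + d) (k := m) (by omega)
  rw [Nat.add_sub_cancel_left, Nat.descFactorial_eq_prod_range] at h
  rw [← h, Nat.cast_mul, Nat.cast_prod]
  congr 1
  refine prod_congr rfl fun k hk => ?_
  rw [Nat.cast_sub]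
  have := mem_range.mp hk
  omega

lemma damping_factor {α : ℂ} (hα : 1 / 2 < α.re) (m d : ℕ) :
    poch α (m + d + 1) ^ 2 / (d.factorial * poch (2 * α - 1) (m + d + 2 + m)) =
      poch α (m + d + 1) ^ 2 / ((m + d).factorial * poch (2 * α - 1) (m + d + 2)) *
        dampingRatio α (m + d) m := by
  have hβ : 0 < (2 * α - 1).re := by simp; linarith
  have hprod : ∏ j ∈ range m, (2 * α - 1 + (m + d + 2 : ℕ) + j) ≠ 0 :=
    prod_ne_zero_iff.mpr fun j _ => by
      rw [add_assoc, ← Nat.cast_add]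
      exact add_natCast_ne_zero hβ _
  have h3 := poch_ne_zero hβ (m + d + 2)
  have h4 : (d.factorial : ℂ) ≠ 0 := by exact_mod_cast d.factorial_ne_zero
  have h5 : ((m + d).factorial : ℂ) ≠ 0 := by exact_mod_cast (m + d).factorial_ne_zero
  rw [dampingRatio, prod_div_distrib, poch_add _ (m + d + 2) m, ← prod_range_natCast_rev]
  rw [← prod_range_natCast_rev] at h5
  have h6 := right_ne_zero_of_mul h5
  field_simp

lemma norm_dampingRatio_le {α : ℂ} (hα : 1 / 2 < α.re) (N m : ℕ) :
    ‖dampingRatio α N m‖ ≤ 1 := by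
  rcases lt_or_ge N m with h | h
  · simp [dampingRatio_eq_zero h]
  · rw [dampingRatio, norm_prod]
    refine prod_le_one (fun _ _ => norm_nonneg _) fun k hk => ?_
    have hk' : k ≤ N := (mem_range.mp hk).le.trans h
    rw [norm_div]
    have hre := Complex.re_le_norm (2 * α - 1 + (N + 2 : ℕ) + k)
    have e : (2 * α - 1 + ((N + 2 : ℕ) : ℂ) + k).re = 2 * α.re - 1 + (N + 2) + k := by simp
    have hn : ‖(N : ℂ) - k‖ ≤ N := by
      rw [← Nat.cast_sub hk', Complex.norm_natCast]
      exact_mod_cast Nat.sub_le N k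
    have : (0 : ℝ) ≤ k := k.cast_nonneg
    refine div_le_one_of_le₀ ?_ (norm_nonneg _)
    linarith

lemma tendsto_natCast_add_div (a b : ℂ) :
    Tendsto (fun N : ℕ => ((N : ℂ) + a) / ((N : ℂ) + b)) atTop (𝓝 1) := by
  have h (c : ℂ) : Tendsto (fun N : ℕ => 1 + c * (N : ℂ)⁻¹) atTop (𝓝 1) := by
    simpa using (tendsto_inv_atTop_nhds_zero_nat (𝕜 := ℂ)).const_mul c |>.const_add 1
  have h' := (h a).div (h b) one_ne_zero
  rw [div_one] at h'
  refine h'.congr' ?_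
  filter_upwards [eventually_gt_atTop 0] with N hN
  have : (N : ℂ) ≠ 0 := by exact_mod_cast hN.ne'
  simp only [Pi.div_apply]
  rw [← mul_div_mul_left _ _ this]
  congr 1 <;> field_simp

lemma tendsto_dampingRatio (α : ℂ) (m : ℕ) :
    Tendsto (fun N => dampingRatio α N m) atTop (𝓝 1) := by
  have h := tendsto_finsetProd (range m) fun k _ =>
    tendsto_natCast_add_div (-(k : ℂ)) (2 * α - 1 + 2 + k)
  rw [prod_const_one] at h
  refine h.congr fun N => prod_congr rfl fun k _ => ?_
  push_cast
  congr 1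
  ring

lemma GammaSeq_eq (a : ℂ) (n : ℕ) :
    Complex.GammaSeq a n = (n : ℂ) ^ a * n.factorial / poch a (n + 1) := rfl

lemma tendsto_prefactor {α : ℂ} (hα : 1 / 2 < α.re) :
    Tendsto (fun N : ℕ =>
        poch α (N + 1) ^ 2 / (N.factorial * poch (2 * α - 1) (N + 2))) atTop
      (𝓝 (Complex.Gamma (2 * α - 1) / Complex.Gamma α ^ 2)) := by
  have hα0 : 0 < α.re := by linarith
  have hβ : 0 < (2 * α - 1).re := by simp; linarith
  have h := ((Complex.GammaSeq_tendsto_Gamma (2 * α - 1)).div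
    ((Complex.GammaSeq_tendsto_Gamma α).pow 2)
      (pow_ne_zero 2 (Complex.Gamma_ne_zero_of_re_pos hα0))).mul
    (tendsto_natCast_add_div 0 (2 * α))
  rw [mul_one] at h
  refine h.congr' ?_
  filter_upwards [eventually_gt_atTop 0] with N hN
  have hN0 : (N : ℂ) ≠ 0 := by exact_mod_cast hN.ne'
  have h1 := poch_ne_zero hα0 (N + 1)
  have h2 := poch_ne_zero hβ (N + 1)
  have h3 : (N : ℂ) + 2 * α ≠ 0 := by
    rw [add_comm]
    exact add_natCast_ne_zero (by simpa using hα0) N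
  have h4 : (N.factorial : ℂ) ≠ 0 := by exact_mod_cast N.factorial_ne_zero
  have h5 : (N : ℂ) ^ α ≠ 0 := by simp [Complex.cpow_eq_zero_iff, hN0]
  have e : (N : ℂ) ^ (2 * α - 1) = (N : ℂ) ^ α * (N : ℂ) ^ α / N := by
    rw [Complex.cpow_sub _ _ hN0, two_mul, Complex.cpow_add _ _ hN0, Complex.cpow_one]
  have e' : 2 * α - 1 + ((N + 1 : ℕ) : ℂ) = N + 2 * α := by
    push_cast
    ring
  simp only [Pi.div_apply]
  rw [GammaSeq_eq, GammaSeq_eq, poch_succ _ (N + 1), e, e', add_zero]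
  field_simp

/-! ### Summability -/

lemma le_norm_natCast_add {α : ℂ} (hα : 0 < α.re) (n : ℕ) : (n : ℝ) ≤ ‖(n : ℂ) + α‖ := by
  have := Complex.re_le_norm ((n : ℂ) + α)
  simp only [Complex.add_re, Complex.natCast_re] at this
  linarith

lemma summable_series {s : ℕ} {α : ℂ} (h1 : 1 / 2 < α.re) (h2 : α.re < s + 1 / 2) :
    Summable fun m : ℕ => poch (2 * α - 1) (m + 1) / (m.factorial : ℂ) *
      ((-1 : ℂ) ^ m / ((m : ℂ) + α) ^ (2 * s + 1)) := by
  have hα0 : 0 < α.re := by linarith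
  have hβ : 0 < (2 * α - 1).re := by simp; linarith
  have hβe : (2 * α - 1).re = 2 * α.re - 1 := by simp
  have hsum : Summable fun m : ℕ => (m : ℝ) ^ (2 * α.re - 1 - (2 * s + 1)) :=
    Real.summable_nat_rpow.mpr (by linarith)
  refine summable_of_isBigO_nat hsum ?_
  have hG := (Complex.GammaSeq_tendsto_Gamma (2 * α - 1)).inv₀
    (Complex.Gamma_ne_zero_of_re_pos hβ)
  obtain ⟨C, hC⟩ := hG.norm.bddAbove_range
  refine Asymptotics.IsBigO.of_bound C ?_
  filter_upwards [eventually_gt_atTop 0] with m hm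
  have hm0 : (m : ℂ) ≠ 0 := by exact_mod_cast hm.ne'
  have hmR : (0 : ℝ) < m := by exact_mod_cast hm
  have hCm : ‖(Complex.GammaSeq (2 * α - 1) m)⁻¹‖ ≤ C := hC ⟨m, rfl⟩
  have hp := poch_ne_zero hβ (m + 1)
  have h4 : (m.factorial : ℂ) ≠ 0 := by exact_mod_cast m.factorial_ne_zero
  have h5 : (m : ℂ) ^ (2 * α - 1) ≠ 0 := by simp [Complex.cpow_eq_zero_iff, hm0]
  have e : poch (2 * α - 1) (m + 1) / (m.factorial : ℂ) =
      (Complex.GammaSeq (2 * α - 1) m)⁻¹ * (m : ℂ) ^ (2 * α - 1) := by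
    rw [GammaSeq_eq]
    field_simp
  rw [e, norm_mul, norm_mul, norm_div, norm_pow, norm_pow, norm_neg, norm_one, one_pow,
    Complex.norm_natCast_cpow_of_pos hm, hβe, Real.rpow_sub hmR _ (2 * s + 1), mul_assoc,
    Real.norm_of_nonneg (by positivity), div_eq_mul_one_div ((m : ℝ) ^ (2 * α.re - 1))]
  have e2 : (m : ℝ) ^ ((2 : ℝ) * s + 1) = (m : ℝ) ^ (2 * s + 1) := by
    rw [← Real.rpow_natCast]
    norm_num
  rw [e2]
  have hC0 : 0 ≤ C := (norm_nonneg _).trans hCm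
  gcongr
  exact le_norm_natCast_add hα0 m

lemma summable_prod_fin {f : ℕ → ℝ} (hf : ∀ n, 0 ≤ f n) (hs : Summable f) (s : ℕ) :
    Summable fun m : Fin s → ℕ => ∏ i, f (m i) := by
  refine summable_of_sum_le (c := (∑' n, f n) ^ s) (fun m => prod_nonneg fun i _ => hf _) fun u => ?_
  classical
  calc ∑ m ∈ u, ∏ i, f (m i)
      ≤ ∑ m ∈ Fintype.piFinset fun i => u.image fun m => m i, ∏ i, f (m i) := by
        refine sum_le_sum_of_subset_of_nonneg (fun m hm => ?_)
          fun m _ _ => prod_nonneg fun i _ => hf _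
        exact Fintype.mem_piFinset.mpr fun i => mem_image_of_mem _ hm
    _ = ∏ i : Fin s, ∑ n ∈ u.image fun m => m i, f n := by rw [prod_univ_sum]
    _ ≤ ∏ _i : Fin s, ∑' n, f n := by
        refine prod_le_prod (fun i _ => sum_nonneg fun n _ => hf n) fun i _ => ?_
        exact hs.sum_le_tsum _ fun n _ => hf n
    _ = _ := by simp

lemma tendsto_starSum {x : ℕ → ℂ} (hx : Summable fun n => ‖x n‖) (s : ℕ) :
    Tendsto (fun N => starSum x s N) atTop
      (𝓝 (∑' m : Fin s → ℕ, open Classical in if Monotone m then ∏ i, x (m i) else 0)) := by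
  classical
  have hsum : Summable fun m : Fin s → ℕ => if Monotone m then ∏ i, x (m i) else 0 := by
    refine Summable.of_norm_bounded (summable_prod_fin (fun n => norm_nonneg (x n)) hx s) fun m => ?_
    split_ifs
    · rw [norm_prod]
    · rw [norm_zero]
      exact prod_nonneg fun i _ => norm_nonneg _
  have hbox : Tendsto (fun N : ℕ => Fintype.piFinset fun _ : Fin s => range (N + 1)) atTop atTop := by
    refine tendsto_atTop_finset_of_monotone (fun M N h => ?_) fun m => ?_
    · exact Fintype.piFinset_subset _ _ fun _ => range_mono (by omega)
    · refine ⟨univ.sup m, Fintype.mem_piFinset.mpr fun i => mem_range.mpr ?_⟩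
      exact Nat.lt_succ_of_le (le_sup (mem_univ i))
  refine (hsum.hasSum.comp hbox).congr fun N => ?_
  simp only [Function.comp, starSum, monoTuples]
  rw [sum_filter]

lemma summable_norm_inv_sq {α : ℂ} (hα : 0 < α.re) :
    Summable fun n : ℕ => ‖(((n : ℂ) + α) ^ 2)⁻¹‖ := by
  refine summable_of_isBigO_nat (Real.summable_nat_pow_inv.mpr one_lt_two)
    (Asymptotics.IsBigO.of_bound 1 ?_)
  filter_upwards [eventually_gt_atTop 0] with n hn
  have hnR : (0 : ℝ) < n := by exact_mod_cast hn
  rw [norm_norm, norm_inv, norm_pow, Real.norm_of_nonneg (by positivity), one_mul]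
  gcongr
  exact le_norm_natCast_add hα n

/-! ### Passage to the limit -/

lemma starSum_eq_tsum {s : ℕ} {α : ℂ} (hα : 1 / 2 < α.re) (N : ℕ) :
    starSum (fun n : ℕ => (((n : ℂ) + α) ^ 2)⁻¹) s N =
      ∑' m : ℕ, poch (2 * α - 1) (m + 1) / (m.factorial : ℂ) *
        ((-1 : ℂ) ^ m / ((m : ℂ) + α) ^ (2 * s + 1)) *
        (2 * (poch α (N + 1) ^ 2 / (N.factorial * poch (2 * α - 1) (N + 2))) *
          dampingRatio α N m) := by
  have hα0 : 0 < α.re := by linarith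
  have hne (n : ℕ) : (n : ℂ) + α ≠ 0 := by rw [add_comm]; exact add_natCast_ne_zero hα0 n
  rw [starSum_eq_sum_lagrangeWeight (v := fun n : ℕ => ((n : ℂ) + α) ^ 2) (injective_sq hα0)
    (fun n => pow_ne_zero 2 (hne n)), tsum_eq_sum (s := range (N + 1))]
  · refine sum_congr rfl fun m hm => ?_
    obtain ⟨d, rfl⟩ := Nat.exists_eq_add_of_le (Nat.lt_succ_iff.mp (mem_range.mp hm))
    rw [lagrangeWeight_sq hα, damping_factor hα, inv_pow, ← pow_mul, pow_succ _ (2 * s)]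
    have := hne m
    field_simp
  · intro m hm
    rw [dampingRatio_eq_zero (by simpa [Nat.lt_succ_iff] using hm)]
    simp

end StarSum

theorem stmt6 (s : ℕ) (hs : 1 ≤ s) (α : ℂ) (h1 : 1 / 2 < α.re) (h2 : α.re < s + 1 / 2) :
    2 * ∑' m : ℕ,
        ((ascPochhammer ℂ (m + 1)).eval (2 * α - 1) / (Nat.factorial m : ℂ))
          * ((-1 : ℂ) ^ m / ((m : ℂ) + α) ^ (2 * s + 1))
    = (Complex.Gamma α) ^ 2 / Complex.Gamma (2 * α - 1)
      * ∑' m : Fin s → ℕ, if Monotone m then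
          ∏ i, (1 : ℂ) / (((m i : ℂ) + α) ^ 2) else 0 := by
  open StarSum Filter Topology in
  have hα0 : 0 < α.re := by linarith
  have hβ : 0 < (2 * α - 1).re := by simp; linarith
  have hΓα := Complex.Gamma_ne_zero_of_re_pos hα0
  have hΓβ := Complex.Gamma_ne_zero_of_re_pos hβ
  have hleft := tendsto_starSum (summable_norm_inv_sq hα0) s
  have hpre := (tendsto_prefactor h1).const_mul 2
  obtain ⟨C, hC⟩ := hpre.norm.bddAbove_range
  have hright := tendsto_tsum_of_dominated_convergence
    ((summable_series h1 h2).norm.mul_right C)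
    (fun m => (hpre.mul (tendsto_dampingRatio α m)).const_mul
      (poch (2 * α - 1) (m + 1) / (m.factorial : ℂ) *
        ((-1 : ℂ) ^ m / ((m : ℂ) + α) ^ (2 * s + 1))))
    (Eventually.of_forall fun N m => by
      rw [norm_mul, norm_mul _ (dampingRatio α N m)]
      have hCN := hC ⟨N, rfl⟩
      refine mul_le_mul_of_nonneg_left ?_ (norm_nonneg _)
      exact (mul_le_of_le_one_right (norm_nonneg _) (norm_dampingRatio_le h1 N m)).trans hCN)
  have key := tendsto_nhds_unique hleft (hright.congr fun N => (starSum_eq_tsum h1 N).symm)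
  rw [tsum_mul_right] at key
  simp only [ascPochhammer_eval, one_div]
  convert congrArg (Complex.Gamma α ^ 2 / Complex.Gamma (2 * α - 1) * ·) key.symm using 1
  · field_simp
end

section
/- Duality formula for multiple Hurwitz zeta values: for admissible index (k₁,…,k_p) (kᵢ ≥ 1, k_p ≥ 2) with dual index (k'₁,…,k'_q), and complex α with Re(α) > 0, Σ_{0≤m₁<⋯<m_p<∞} Π_{i=1}^p 1/(mᵢ+α)^{kᵢ} = Σ_{0≤m₁<⋯<m_q<∞} [(m_q+1)!/(α)_{m_q+1}] Π_{i=1}^q 1/(mᵢ+1)^{k'ᵢ}. -/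
open scoped BigOperators

/-- The index ({1}^{a₁-1}, b₁+1, …, {1}^{a_h-1}, b_h+1) built from the pairs (aᵢ, bᵢ). -/
def indexOf (ab : List (ℕ × ℕ)) : List ℕ :=
  ab.flatMap fun p => List.replicate (p.1 - 1) 1 ++ [p.2 + 1]

/-- The dual index ({1}^{b_h-1}, a_h+1, …, {1}^{b₁-1}, a₁+1). -/
def dualIndexOf (ab : List (ℕ × ℕ)) : List ℕ :=
  indexOf ((ab.map Prod.swap).reverse)

/-- Multiple Hurwitz zeta value Σ_{0≤m₁<⋯<m_p} ∏ 1/(mᵢ+α)^{kᵢ}. -/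
noncomputable def mhz (α : ℂ) {p : ℕ} (k : Fin p → ℕ) : ℂ :=
  ∑' m : Fin p → ℕ, if StrictMono m then ∏ i, (1 : ℂ) / (((m i : ℂ) + α) ^ (k i)) else 0

section Connector

variable {K : Type*} [Field K]

/-- The weight `1 / (M - 1 + α)` attached to a shifted summation variable `M ≥ 1`. -/
def hurwitzWeight (α : K) : ℕ → K
  | 0 => 0
  | m + 1 => 1 / ((m : K) + α)

/-- The connector `n! / (M + α)_n`. -/
def connector (α : K) (M n : ℕ) : K :=
  ∏ j ∈ Finset.range n, ((j : K) + 1) / ((M : K) + j + α)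

/-- The nested partial sums attached to a word; the head of the list is the outermost letter,
`true` opens a new summation variable and `false` multiplies by the weight once more. -/
def wordSum (u : ℕ → K) : List Bool → ℕ → K
  | [], M => if M = 0 then 1 else 0
  | true :: w, M => u M * ∑ a ∈ Finset.range M, wordSum u w a
  | false :: w, M => u M * wordSum u w M

/-- The summand of the connected sum of two words. -/
def connectedTerm (α : K) (w w' : List Bool) (x : ℕ × ℕ) : K :=
  wordSum (hurwitzWeight α) w x.1 * connector α x.1 x.2 * wordSum (hurwitzWeight 1) w' x.2

lemma wordSum_zero {u : ℕ → K} (hu : u 0 = 0) {w : List Bool} (hw : w ≠ []) :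
    wordSum u w 0 = 0 := by
  match w with
  | true :: w => simp [wordSum]
  | false :: w => simp [wordSum, hu]

lemma connector_zero_right (α : K) (M : ℕ) : connector α M 0 = 1 := by
  simp [connector]

lemma connector_succ_right (α : K) (M n : ℕ) :
    connector α M (n + 1) = connector α M n * (((n : K) + 1) / ((M : K) + n + α)) := by
  rw [connector, Finset.prod_range_succ, ← connector]

lemma connector_shift {α : K} (hα : ∀ j : ℕ, (j : K) + α ≠ 0) (M n : ℕ) :
    connector α (M + 1) n * ((M : K) + n + α) = connector α M n * ((M : K) + α) := by
  induction n with
  | zero => simp [connector]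
  | succ n ih =>
    have h1 := hα (M + n)
    have h2 := hα (M + n + 1)
    rw [connector_succ_right, connector_succ_right]
    push_cast at *
    have h3 : (M : K) + 1 + n + α ≠ 0 := by convert h2 using 1; ring
    rw [div_eq_mul_inv, div_eq_mul_inv]
    have e1 : ((M : K) + 1 + n + α)⁻¹ * ((M : K) + (n + 1) + α) = 1 := by
      rw [show (M : K) + (n + 1) + α = (M : K) + 1 + n + α by ring]; exact inv_mul_cancel₀ h3
    have e2 : ((M : K) + n + α)⁻¹ * ((M : K) + n + α) = 1 := inv_mul_cancel₀ h1
    linear_combination connector α (M + 1) n * (n + 1) * e1 -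
      connector α (M + 1) n * (n + 1) * e2 + ((n : K) + 1) * ((M : K) + n + α)⁻¹ * ih

lemma connector_sub_left {α : K} (hα : ∀ j : ℕ, (j : K) + α ≠ 0) (M n : ℕ) :
    connector α M n - connector α (M + 1) n =
      n * (hurwitzWeight α (M + 1) * connector α (M + 1) n) := by
  have h := connector_shift hα M n
  have h0 := hα M
  simp only [hurwitzWeight]
  field_simp
  linear_combination -h

lemma connector_sub_right {α : K} (hα : ∀ j : ℕ, (j : K) + α ≠ 0)
    (h1 : ∀ j : ℕ, (j : K) + 1 ≠ 0) (M n : ℕ) :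
    connector α (M + 1) n - connector α (M + 1) (n + 1) =
      ((M : K) + α) * (hurwitzWeight 1 (n + 1) * connector α (M + 1) (n + 1)) := by
  have h2 := hα (M + n + 1)
  have h3 := h1 n
  push_cast at h2
  have h4 : (M : K) + 1 + n + α ≠ 0 := by convert h2 using 1; ring
  rw [connector_succ_right]
  simp only [hurwitzWeight]
  push_cast
  field_simp
  ring

end Connector

section Telescoping

lemma hasSum_telescope {E : ℕ → ℂ} (hE : Filter.Tendsto E Filter.atTop (nhds 0))
    (hs : Summable fun i => E i - E (i + 1)) (a : ℕ) :
    HasSum (fun M => if a < M then E (M - 1) - E M else 0) (E a) := by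
  have hinj : Function.Injective fun i : ℕ => a + 1 + i := fun i j h => by simpa using h
  rw [← hinj.hasSum_iff (fun M hM => if_neg fun h => hM ⟨M - (a + 1), by dsimp only; omega⟩)]
  have e : ((fun M => if a < M then E (M - 1) - E M else 0) ∘ fun i : ℕ => a + 1 + i)
      = fun i => E (i + a) - E (i + a + 1) := by
    funext i
    have h : a < a + 1 + i := by omega
    simp only [Function.comp_apply, if_pos h]
    congr 2 <;> omega
  rw [e]
  have hs' : Summable fun i => E (i + a) - E (i + a + 1) :=
    (summable_nat_add_iff (f := fun i => E i - E (i + 1)) a).2 hs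
  rw [hs'.hasSum_iff_tendsto_nat]
  have e2 : ∀ n, ∑ i ∈ Finset.range n, (E (i + a) - E (i + a + 1)) = E a - E (n + a) := by
    intro n
    have := Finset.sum_range_sub' (fun i => E (i + a)) n
    simp only [zero_add] at this
    rw [← this]
    exact Finset.sum_congr rfl fun i _ => by congr 2; omega
  simp_rw [e2]
  have := (Filter.tendsto_add_atTop_iff_nat a).2 hE
  simpa using tendsto_const_nhds.sub this

lemma summable_sub_succ_of_antitone {E : ℕ → ℝ} (hE : Antitone E) (h0 : ∀ n, 0 ≤ E n) :
    Summable fun i => E i - E (i + 1) := by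
  refine summable_of_sum_range_le (c := E 0) (fun n => sub_nonneg.2 (hE n.le_succ)) fun n => ?_
  rw [Finset.sum_range_sub']
  linarith [h0 n]

end Telescoping

section Estimates

variable {α : ℂ}

lemma natCast_add_ne_zero (hα : 0 < α.re) (j : ℕ) : (j : ℂ) + α ≠ 0 := by
  intro h
  have := congrArg Complex.re h
  simp at this
  have : (0 : ℝ) ≤ j := j.cast_nonneg
  linarith

lemma re_le_norm_natCast_add (α : ℂ) (j : ℕ) : (j : ℝ) + α.re ≤ ‖(j : ℂ) + α‖ := by
  simpa using Complex.re_le_norm ((j : ℂ) + α)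

lemma norm_hurwitzWeight_le (hα : 0 < α.re) (M : ℕ) :
    ‖hurwitzWeight α M‖ ≤ hurwitzWeight α.re M := by
  cases M with
  | zero => simp [hurwitzWeight]
  | succ m =>
    simp only [hurwitzWeight, norm_div, norm_one]
    exact one_div_le_one_div_of_le (by positivity) (re_le_norm_natCast_add α m)

lemma hurwitzWeight_nonneg {r : ℝ} (hr : 0 < r) (M : ℕ) : 0 ≤ hurwitzWeight r M := by
  cases M with
  | zero => simp [hurwitzWeight]
  | succ m => simp only [hurwitzWeight]; positivity

lemma connector_nonneg {r : ℝ} (hr : 0 < r) (M n : ℕ) : 0 ≤ connector r M n :=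
  Finset.prod_nonneg fun j _ => by positivity

lemma norm_connector_le (hα : 0 < α.re) (M n : ℕ) :
    ‖connector α M n‖ ≤ connector α.re M n := by
  rw [connector, norm_prod]
  refine Finset.prod_le_prod (fun _ _ => norm_nonneg _) fun j _ => ?_
  rw [norm_div]
  have h1 : ‖(j : ℂ) + 1‖ = (j : ℝ) + 1 := by
    rw [← Nat.cast_succ, Complex.norm_natCast, Nat.cast_succ]
  have h2 := re_le_norm_natCast_add α (M + j)
  push_cast at h2
  rw [h1]
  gcongr

lemma wordSum_nonneg {u : ℕ → ℝ} (hu : ∀ M, 0 ≤ u M) (w : List Bool) (M : ℕ) :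
    0 ≤ wordSum u w M := by
  induction w generalizing M with
  | nil => simp only [wordSum]; split_ifs <;> simp
  | cons c w ih =>
    cases c with
    | true => exact mul_nonneg (hu M) (Finset.sum_nonneg fun a _ => ih a)
    | false => exact mul_nonneg (hu M) (ih M)

lemma norm_wordSum_le {u : ℕ → ℂ} {v : ℕ → ℝ} (huv : ∀ M, ‖u M‖ ≤ v M) (w : List Bool) (M : ℕ) :
    ‖wordSum u w M‖ ≤ wordSum v w M := by
  have hv : ∀ M, 0 ≤ v M := fun M => (norm_nonneg _).trans (huv M)
  induction w generalizing M with
  | nil => simp only [wordSum]; split_ifs <;> simp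
  | cons c w ih =>
    cases c with
    | true =>
      simp only [wordSum, norm_mul]
      exact mul_le_mul (huv M) ((norm_sum_le _ _).trans (Finset.sum_le_sum fun a _ => ih a))
        (norm_nonneg _) (hv M)
    | false =>
      simp only [wordSum, norm_mul]
      exact mul_le_mul (huv M) (ih M) (norm_nonneg _) (hv M)

lemma tendsto_connector_left (hα : 0 < α.re) {n : ℕ} (hn : n ≠ 0) :
    Filter.Tendsto (fun M => connector α M n) Filter.atTop (nhds 0) := by
  have h : ∀ j ∈ Finset.range n, Filter.Tendsto (fun M : ℕ => ((j : ℝ) + 1) / ((M : ℝ) + j + α.re))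
      Filter.atTop (nhds 0) := by
    intro j _
    simp_rw [add_assoc]
    exact tendsto_const_nhds.div_atTop
      (Filter.tendsto_atTop_add_const_right _ _ tendsto_natCast_atTop_atTop)
  refine squeeze_zero_norm (fun M => norm_connector_le hα M n) ?_
  have := tendsto_finsetProd _ h
  rwa [Finset.prod_const, Finset.card_range, zero_pow hn] at this

lemma tendsto_connector_right (hα : 0 < α.re) (M : ℕ) :
    Filter.Tendsto (fun n => connector α (M + 1) n) Filter.atTop (nhds 0) := by
  have hb : ∀ n, ‖connector α (M + 1) n‖ ≤
      (1 + α.re * ∑ i ∈ Finset.range n, 1 / ((i : ℝ) + 1))⁻¹ := by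
    intro n
    refine (norm_connector_le hα _ _).trans ?_
    induction n with
    | zero => simp [connector]
    | succ n ih =>
      set H := ∑ i ∈ Finset.range n, 1 / ((i : ℝ) + 1) with hH
      have hH0 : 0 ≤ H := Finset.sum_nonneg fun i _ => by positivity
      rw [connector_succ_right, Finset.sum_range_succ, ← hH]
      have : ((n : ℝ) + 1) / (((M + 1 : ℕ) : ℝ) + n + α.re) ≤ (1 + α.re / (n + 1))⁻¹ := by
        rw [← one_div, div_le_div_iff₀ (by positivity) (by positivity)]
        have : ((n : ℝ) + 1) * (1 + α.re / (n + 1)) = n + 1 + α.re := by field_simp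
        rw [this]; push_cast; have : (0 : ℝ) ≤ M := M.cast_nonneg
        linarith
      refine (mul_le_mul ih this (by positivity) (by positivity)).trans ?_
      rw [← mul_inv]
      refine inv_anti₀ (by positivity) ?_
      have : 0 ≤ α.re * H * (α.re / (n + 1)) := by positivity
      calc _ = 1 + α.re * H + α.re / (n + 1) := by ring
        _ ≤ _ := by nlinarith
  refine squeeze_zero_norm hb (Filter.Tendsto.inv_tendsto_atTop ?_)
  exact Filter.tendsto_atTop_add_const_left _ _
    (Real.tendsto_sum_range_one_div_nat_succ_atTop.const_mul_atTop hα)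

end Estimates

section Transport

lemma summable_tsum_exchange {N I J : Type*} {T : N → I → J → ℂ} {T' : N → I → J → ℝ}
    (hT : ∀ n i j, ‖T n i j‖ ≤ T' n i j)
    {A : N × I → ℂ} {A' : N × I → ℝ} {B : N × J → ℂ} {B' : N × J → ℝ}
    (hA : ∀ x, HasSum (T x.1 x.2) (A x)) (hA' : ∀ x, HasSum (T' x.1 x.2) (A' x))
    (hB : ∀ x, HasSum (fun i => T x.1 i x.2) (B x))
    (hB' : ∀ x, HasSum (fun i => T' x.1 i x.2) (B' x))
    (hs : Summable A') :
    Summable B' ∧ ∑' x, A x = ∑' x, B x := by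
  have h0 : ∀ n i j, 0 ≤ T' n i j := fun n i j => (norm_nonneg _).trans (hT n i j)
  have hs' : Summable fun y : (N × I) × J => T' y.1.1 y.1.2 y.2 := by
    rw [summable_prod_of_nonneg (fun _ => h0 _ _ _)]
    refine ⟨fun x => (hA' x).summable, ?_⟩
    simpa only [(hA' _).tsum_eq] using hs
  let e : (N × J) × I ≃ (N × I) × J :=
    { toFun := fun y => ((y.1.1, y.2), y.1.2)
      invFun := fun y => ((y.1.1, y.2), y.1.2)
      left_inv := fun _ => rfl
      right_inv := fun _ => rfl }
  have hsT : Summable fun y : (N × I) × J => T y.1.1 y.1.2 y.2 :=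
    Summable.of_norm_bounded hs' fun _ => hT _ _ _
  have hs2 : Summable fun y : (N × J) × I => T' y.1.1 y.2 y.1.2 := e.summable_iff.2 hs'
  have hsT2 : Summable fun y : (N × J) × I => T y.1.1 y.2 y.1.2 := e.summable_iff.2 hsT
  have hsB := ((summable_prod_of_nonneg (fun _ => h0 _ _ _)).1 hs2).2
  simp only [(hB' _).tsum_eq] at hsB
  refine ⟨hsB, ?_⟩
  calc ∑' x, A x = ∑' y : (N × I) × J, T y.1.1 y.1.2 y.2 := by
        rw [hsT.tsum_prod' fun x => (hA x).summable]
        exact tsum_congr fun x => (hA x).tsum_eq.symm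
    _ = ∑' y : (N × J) × I, T y.1.1 y.2 y.1.2 :=
        (e.tsum_eq fun y : (N × I) × J => T y.1.1 y.1.2 y.2).symm
    _ = ∑' x, B x := by
        rw [hsT2.tsum_prod' fun x => (hB x).summable]
        exact tsum_congr fun x => (hB x).tsum_eq

lemma hasSum_hurwitzWeight_connector_left {α : ℂ} (hα : 0 < α.re) {n : ℕ} (hn : n ≠ 0) (a : ℕ) :
    HasSum (fun M => if a < M then hurwitzWeight α M * connector α M n else 0)
      (hurwitzWeight 1 n * connector α a n) := by
  have hn' : (n : ℂ) ≠ 0 := Nat.cast_ne_zero.2 hn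
  have hw : hurwitzWeight (1 : ℂ) n = (n : ℂ)⁻¹ := by
    cases n with
    | zero => exact absurd rfl hn
    | succ n => simp [hurwitzWeight]
  have hr : ∀ j : ℕ, (j : ℝ) + α.re ≠ 0 := fun j => by positivity
  have hanti : Antitone fun M => connector α.re M n := antitone_nat_of_succ_le fun M => by
    have h := connector_sub_left hr M n
    have h1 := hurwitzWeight_nonneg hα (M + 1)
    have h2 := connector_nonneg hα (M + 1) n
    have : 0 ≤ (n : ℝ) * (hurwitzWeight α.re (M + 1) * connector α.re (M + 1) n) := by positivity
    linarith
  have hs : Summable fun M => connector α M n - connector α (M + 1) n := by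
    refine Summable.of_norm_bounded
      (summable_sub_succ_of_antitone hanti fun M => connector_nonneg hα M n) fun M => ?_
    rw [connector_sub_left (natCast_add_ne_zero hα), connector_sub_left hr, norm_mul, norm_mul,
      Complex.norm_natCast]
    gcongr
    · exact hurwitzWeight_nonneg hα _
    · exact norm_hurwitzWeight_le hα _
    · exact norm_connector_le hα _ _
  have := (hasSum_telescope (tendsto_connector_left hα hn) hs a).mul_left (n : ℂ)⁻¹
  rw [hw]
  refine this.congr_fun ?_
  intro M
  split_ifs with h
  · obtain ⟨m, rfl⟩ : ∃ m, M = m + 1 := ⟨M - 1, by omega⟩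
    rw [Nat.add_sub_cancel, connector_sub_left (natCast_add_ne_zero hα), inv_mul_cancel_left₀ hn']
  · simp

lemma hasSum_hurwitzWeight_connector_right {α : ℂ} (hα : 0 < α.re) {M : ℕ} (hM : M ≠ 0) (a : ℕ) :
    HasSum (fun n => if a < n then hurwitzWeight 1 n * connector α M n else 0)
      (hurwitzWeight α M * connector α M a) := by
  obtain ⟨m, rfl⟩ : ∃ m, M = m + 1 := ⟨M - 1, by omega⟩
  have hm := natCast_add_ne_zero hα m
  have hr : ∀ j : ℕ, (j : ℝ) + α.re ≠ 0 := fun j => by positivity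
  have hc (n : ℕ) := connector_sub_right (natCast_add_ne_zero hα)
    (fun j => Nat.cast_add_one_ne_zero j) m n
  have hcr (n : ℕ) := connector_sub_right hr (fun j => Nat.cast_add_one_ne_zero j) m n
  have h0 (n : ℕ) : 0 ≤ hurwitzWeight 1 (n + 1) * connector α.re (m + 1) (n + 1) :=
    mul_nonneg (hurwitzWeight_nonneg one_pos _) (connector_nonneg hα _ _)
  have hanti : Antitone fun n => connector α.re (m + 1) n := antitone_nat_of_succ_le fun n => by
    have := hcr n
    have : 0 ≤ ((m : ℝ) + α.re) * (hurwitzWeight 1 (n + 1) * connector α.re (m + 1) (n + 1)) :=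
      mul_nonneg (by positivity) (h0 n)
    linarith
  have hs : Summable fun n => connector α (m + 1) n - connector α (m + 1) (n + 1) := by
    have hsr := summable_sub_succ_of_antitone hanti fun n => connector_nonneg hα _ n
    simp_rw [hcr] at hsr
    rw [summable_mul_left_iff (hr m)] at hsr
    simp_rw [hc]
    refine Summable.mul_left _ (Summable.of_norm_bounded hsr fun n => ?_)
    rw [norm_mul]
    have h1 : ‖hurwitzWeight (1 : ℂ) (n + 1)‖ ≤ hurwitzWeight 1 (n + 1) := by
      simpa using norm_hurwitzWeight_le (α := 1) (by simp) (n + 1)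
    exact mul_le_mul h1 (norm_connector_le hα _ _) (norm_nonneg _)
      (hurwitzWeight_nonneg one_pos _)
  have := (hasSum_telescope (tendsto_connector_right hα m) hs a).mul_left ((m : ℂ) + α)⁻¹
  rw [hurwitzWeight, one_div]
  refine this.congr_fun ?_
  intro n
  split_ifs with h
  · obtain ⟨n, rfl⟩ : ∃ k, n = k + 1 := ⟨n - 1, by omega⟩
    rw [Nat.add_sub_cancel, hc, inv_mul_cancel_left₀ hm]
  · simp

end Transport

section ConnectedSums

lemma ofReal_hurwitzWeight (r : ℝ) (M : ℕ) :
    ((hurwitzWeight r M : ℝ) : ℂ) = hurwitzWeight (r : ℂ) M := by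
  cases M <;> simp [hurwitzWeight]

lemma ofReal_connector (r : ℝ) (M n : ℕ) :
    ((connector r M n : ℝ) : ℂ) = connector (r : ℂ) M n := by
  simp [connector]

lemma hasSum_hurwitzWeight_connector_left_real {r : ℝ} (hr : 0 < r) {n : ℕ} (hn : n ≠ 0) (a : ℕ) :
    HasSum (fun M => if a < M then hurwitzWeight r M * connector r M n else 0)
      (hurwitzWeight 1 n * connector r a n) := by
  rw [← Complex.hasSum_ofReal]
  have := hasSum_hurwitzWeight_connector_left (α := (r : ℂ)) (by simpa using hr) hn a
  push_cast [apply_ite Complex.ofReal, ofReal_hurwitzWeight, ofReal_connector]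
  exact this

lemma hasSum_hurwitzWeight_connector_right_real {r : ℝ} (hr : 0 < r) {M : ℕ} (hM : M ≠ 0)
    (a : ℕ) :
    HasSum (fun n => if a < n then hurwitzWeight 1 n * connector r M n else 0)
      (hurwitzWeight r M * connector r M a) := by
  rw [← Complex.hasSum_ofReal]
  have := hasSum_hurwitzWeight_connector_right (α := (r : ℂ)) (by simpa using hr) hM a
  push_cast [apply_ite Complex.ofReal, ofReal_hurwitzWeight, ofReal_connector]
  exact this

lemma hasSum_ite_lt {K : Type*} [Field K] [TopologicalSpace K] (f : ℕ → K) (M : ℕ) :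
    HasSum (fun a => if a < M then f a else 0) (∑ a ∈ Finset.range M, f a) := by
  rw [Finset.sum_congr rfl fun a ha => (if_pos (Finset.mem_range.1 ha)).symm]
  exact hasSum_sum_of_ne_finset_zero fun a ha => if_neg fun h => ha (Finset.mem_range.2 h)

lemma norm_hurwitzWeight_one_le (M : ℕ) : ‖hurwitzWeight (1 : ℂ) M‖ ≤ hurwitzWeight 1 M := by
  simpa using norm_hurwitzWeight_le (α := 1) (by simp) M

section Rows

variable {K : Type*} [Field K] [TopologicalSpace K] [IsTopologicalRing K] (α : K)

/-- The threefold summand interpolating between the two sides of the transport of `true`. -/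
def transportTrueTerm (w w' : List Bool) (n M a : ℕ) : K :=
  (if a < M then wordSum (hurwitzWeight α) w a else 0) *
    (hurwitzWeight α M * connector α M n * wordSum (hurwitzWeight 1) w' n)

/-- The threefold summand interpolating between the two sides of the transport of `false`. -/
def transportFalseTerm (w w' : List Bool) (M n b : ℕ) : K :=
  wordSum (hurwitzWeight α) w M * (if n < b then hurwitzWeight 1 b * connector α M b else 0) *
    wordSum (hurwitzWeight 1) w' n

lemma hasSum_transportTrueTerm_inner (w w' : List Bool) (x : ℕ × ℕ) :
    HasSum (transportTrueTerm α w w' x.1 x.2) (connectedTerm α (true :: w) w' x.swap) := by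
  have h := (hasSum_ite_lt (wordSum (hurwitzWeight α) w) x.2).mul_right
    (hurwitzWeight α x.2 * connector α x.2 x.1 * wordSum (hurwitzWeight 1) w' x.1)
  have e : connectedTerm α (true :: w) w' x.swap =
      (∑ a ∈ Finset.range x.2, wordSum (hurwitzWeight α) w a) *
        (hurwitzWeight α x.2 * connector α x.2 x.1 * wordSum (hurwitzWeight 1) w' x.1) := by
    simp only [connectedTerm, wordSum, Prod.swap]; ring
  rw [e]
  exact h

lemma hasSum_transportTrueTerm_middle
    (hc : ∀ n a : ℕ, n ≠ 0 → HasSum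
      (fun M => if a < M then hurwitzWeight α M * connector α M n else 0)
      (hurwitzWeight 1 n * connector α a n))
    (w : List Bool) {w' : List Bool} (hw' : w' ≠ []) (x : ℕ × ℕ) :
    HasSum (fun M => transportTrueTerm α w w' x.1 M x.2)
      (connectedTerm α w (false :: w') x.swap) := by
  obtain ⟨n, a⟩ := x
  rcases eq_or_ne n 0 with rfl | hn
  · simp [transportTrueTerm, connectedTerm, wordSum,
      wordSum_zero (u := hurwitzWeight (1 : K)) rfl hw', hasSum_zero]
  · have h := ((hc n a hn).mul_left (wordSum (hurwitzWeight α) w a)).mul_right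
      (wordSum (hurwitzWeight 1) w' n)
    have e : connectedTerm α w (false :: w') (Prod.swap (n, a)) =
        wordSum (hurwitzWeight α) w a * (hurwitzWeight 1 n * connector α a n) *
          wordSum (hurwitzWeight 1) w' n := by
      simp only [connectedTerm, wordSum, Prod.swap]; ring
    rw [e]
    refine h.congr_fun fun M => ?_
    dsimp only [transportTrueTerm]
    split_ifs <;> ring

lemma hasSum_transportFalseTerm_inner
    (hc : ∀ M a : ℕ, M ≠ 0 → HasSum
      (fun n => if a < n then hurwitzWeight 1 n * connector α M n else 0)
      (hurwitzWeight α M * connector α M a))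
    {w : List Bool} (hw : w ≠ []) (w' : List Bool) (x : ℕ × ℕ) :
    HasSum (transportFalseTerm α w w' x.1 x.2) (connectedTerm α (false :: w) w' x) := by
  obtain ⟨M, n⟩ := x
  rcases eq_or_ne M 0 with rfl | hM
  · have e : transportFalseTerm α w w' (0, n).1 (0, n).2 = fun _ => 0 := by
      funext b
      simp [transportFalseTerm, wordSum_zero (u := hurwitzWeight α) rfl hw]
    rw [e]
    simp [connectedTerm, wordSum, wordSum_zero (u := hurwitzWeight α) rfl hw, hasSum_zero]
  · have h := ((hc M n hM).mul_left (wordSum (hurwitzWeight α) w M)).mul_right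
      (wordSum (hurwitzWeight 1) w' n)
    have e : connectedTerm α (false :: w) w' (M, n) =
        wordSum (hurwitzWeight α) w M * (hurwitzWeight α M * connector α M n) *
          wordSum (hurwitzWeight 1) w' n := by
      simp only [connectedTerm, wordSum]; ring
    rw [e]
    exact h

lemma hasSum_transportFalseTerm_middle (w w' : List Bool) (x : ℕ × ℕ) :
    HasSum (fun n => transportFalseTerm α w w' x.1 n x.2) (connectedTerm α w (true :: w') x) := by
  have h := (hasSum_ite_lt (wordSum (hurwitzWeight 1) w') x.2).mul_left
    (wordSum (hurwitzWeight α) w x.1 * (hurwitzWeight 1 x.2 * connector α x.1 x.2))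
  have e : connectedTerm α w (true :: w') x =
      wordSum (hurwitzWeight α) w x.1 * (hurwitzWeight 1 x.2 * connector α x.1 x.2) *
        ∑ a ∈ Finset.range x.2, wordSum (hurwitzWeight 1) w' a := by
    simp only [connectedTerm, wordSum]; ring
  rw [e]
  refine h.congr_fun fun n => ?_
  dsimp only [transportFalseTerm]
  split_ifs <;> ring

end Rows

lemma connectedSum_transport_true {α : ℂ} (hα : 0 < α.re) (w : List Bool) {w' : List Bool}
    (hw' : w' ≠ []) (hs : Summable (connectedTerm α.re (true :: w) w')) :
    Summable (connectedTerm α.re w (false :: w')) ∧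
      ∑' x, connectedTerm α (true :: w) w' x = ∑' x, connectedTerm α w (false :: w') x := by
  have hnorm : ∀ n M a, ‖transportTrueTerm α w w' n M a‖ ≤ transportTrueTerm α.re w w' n M a := by
    intro n M a
    rw [transportTrueTerm, norm_mul, norm_mul, norm_mul]
    have h1 := hurwitzWeight_nonneg hα M
    have h2 := connector_nonneg hα M n
    have h3 := wordSum_nonneg (hurwitzWeight_nonneg hα) w a
    refine mul_le_mul ?_ (mul_le_mul (mul_le_mul (norm_hurwitzWeight_le hα _)
      (norm_connector_le hα _ _) (norm_nonneg _) h1)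
      (norm_wordSum_le norm_hurwitzWeight_one_le _ _) (norm_nonneg _) (by positivity))
      (by positivity) (by split_ifs <;> simp [h3])
    split_ifs
    · exact norm_wordSum_le (norm_hurwitzWeight_le hα) _ _
    · simp
  have key := summable_tsum_exchange hnorm (hasSum_transportTrueTerm_inner α w w')
    (hasSum_transportTrueTerm_inner α.re w w')
    (hasSum_transportTrueTerm_middle α
      (fun n a hn => hasSum_hurwitzWeight_connector_left hα hn a) w hw')
    (hasSum_transportTrueTerm_middle α.re
      (fun n a hn => hasSum_hurwitzWeight_connector_left_real hα hn a) w hw')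
    ((Equiv.prodComm ℕ ℕ).summable_iff.2 hs)
  refine ⟨(Equiv.prodComm ℕ ℕ).summable_iff.1 key.1, ?_⟩
  rw [← (Equiv.prodComm ℕ ℕ).tsum_eq, ← (Equiv.prodComm ℕ ℕ).tsum_eq (connectedTerm α w _)]
  exact key.2

lemma connectedSum_transport_false {α : ℂ} (hα : 0 < α.re) {w : List Bool} (hw : w ≠ [])
    (w' : List Bool) (hs : Summable (connectedTerm α.re (false :: w) w')) :
    Summable (connectedTerm α.re w (true :: w')) ∧
      ∑' x, connectedTerm α (false :: w) w' x = ∑' x, connectedTerm α w (true :: w') x := by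
  have hnorm : ∀ M n b,
      ‖transportFalseTerm α w w' M n b‖ ≤ transportFalseTerm α.re w w' M n b := by
    intro M n b
    rw [transportFalseTerm, norm_mul, norm_mul]
    have h1 := hurwitzWeight_nonneg one_pos b
    have h2 := connector_nonneg hα M b
    have h3 := wordSum_nonneg (hurwitzWeight_nonneg hα) w M
    have h4 : (0 : ℝ) ≤ if n < b then hurwitzWeight 1 b * connector α.re M b else 0 := by
      split_ifs <;> positivity
    refine mul_le_mul (mul_le_mul (norm_wordSum_le (norm_hurwitzWeight_le hα) _ _) ?_
      (norm_nonneg _) h3) (norm_wordSum_le norm_hurwitzWeight_one_le _ _) (norm_nonneg _)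
      (mul_nonneg h3 h4)
    split_ifs
    · rw [norm_mul]
      exact mul_le_mul (norm_hurwitzWeight_one_le _) (norm_connector_le hα _ _) (norm_nonneg _) h1
    · simp
  exact summable_tsum_exchange hnorm
    (hasSum_transportFalseTerm_inner α
      (fun M a hM => hasSum_hurwitzWeight_connector_right hα hM a) hw w')
    (hasSum_transportFalseTerm_inner α.re
      (fun M a hM => hasSum_hurwitzWeight_connector_right_real hα hM a) hw w')
    (hasSum_transportFalseTerm_middle α w w') (hasSum_transportFalseTerm_middle α.re w w') hs

lemma connectedSum_transport {α : ℂ} (hα : 0 < α.re) (v : List Bool) {w' : List Bool}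
    (hw' : w' ≠ []) (hs : Summable (connectedTerm α.re (v ++ [true]) w')) :
    Summable (connectedTerm α.re [] (((v ++ [true]).map not).reverse ++ w')) ∧
      ∑' x, connectedTerm α (v ++ [true]) w' x =
        ∑' x, connectedTerm α [] (((v ++ [true]).map not).reverse ++ w') x := by
  induction v generalizing w' with
  | nil => exact connectedSum_transport_true hα [] hw' hs
  | cons c v ih =>
    cases c with
    | true =>
      have h := connectedSum_transport_true hα (v ++ [true]) hw' hs
      have h' := ih (List.cons_ne_nil _ _) h.1
      simpa using And.intro h'.1 (h.2.trans h'.2)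
    | false =>
      have h := connectedSum_transport_false hα (w := v ++ [true]) (by simp) w' hs
      have h' := ih (List.cons_ne_nil _ _) h.1
      simpa using And.intro h'.1 (h.2.trans h'.2)

lemma connectedSum_duality {α : ℂ} (hα : 0 < α.re) (v : List Bool)
    (hs : Summable (connectedTerm α.re (false :: v ++ [true]) [])) :
    Summable (connectedTerm α.re [] ((false :: v ++ [true]).map not).reverse) ∧
      ∑' x, connectedTerm α (false :: v ++ [true]) [] x =
        ∑' x, connectedTerm α [] ((false :: v ++ [true]).map not).reverse x := by
  have h := connectedSum_transport_false hα (w := v ++ [true]) (by simp) [] hs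
  have h' := connectedSum_transport hα v (List.cons_ne_nil _ _) h.1
  simpa using And.intro h'.1 (h.2.trans h'.2)

end ConnectedSums

section Convergence

lemma hurwitzWeight_le {r : ℝ} (hr : 0 < r) : ∃ C, 0 ≤ C ∧ ∀ M : ℕ, hurwitzWeight r M ≤ C / M := by
  refine ⟨(min r 1)⁻¹, by positivity, fun M => ?_⟩
  cases M with
  | zero => simp [hurwitzWeight]
  | succ m =>
    have hm : 0 < min r 1 := by positivity
    rw [hurwitzWeight, ← one_div, div_div]
    refine one_div_le_one_div_of_le (by positivity) ?_
    push_cast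
    have h1 := min_le_left r 1
    have h2 := min_le_right r 1
    nlinarith [(m.cast_nonneg : (0 : ℝ) ≤ m)]

lemma sum_range_le_sqrt {f : ℕ → ℝ} {C : ℝ} (h0 : 0 ≤ f 0) (hC : 0 ≤ C)
    (hf : ∀ M, M ≠ 0 → f M ≤ C / √M) (M : ℕ) :
    ∑ a ∈ Finset.range M, f a ≤ (f 0 + 3 * C) * √M := by
  induction M with
  | zero => simp
  | succ M ih =>
    rw [Finset.sum_range_succ]
    rcases eq_or_ne M 0 with rfl | hM
    · simp; linarith
    · have hM' : (0 : ℝ) < M := by positivity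
      have h1 : (1 : ℝ) ≤ M := by exact_mod_cast Nat.one_le_iff_ne_zero.2 hM
      set s := √(M : ℝ) with hs
      set t := √((M + 1 : ℕ) : ℝ) with ht
      have hs0 : 0 < s := Real.sqrt_pos.2 hM'
      have ht0 : 0 ≤ t := Real.sqrt_nonneg _
      have hs2 : s ^ 2 = M := Real.sq_sqrt hM'.le
      have ht2 : t ^ 2 = M + 1 := by rw [ht, Real.sq_sqrt (by positivity)]; push_cast; ring
      have hts : t ≤ 2 * s := by nlinarith
      have hst : s ≤ t := by nlinarith
      have hinv : 1 / s ≤ 3 * (t - s) := by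
        rw [div_le_iff₀ hs0]
        nlinarith
      have h3 : C / s ≤ C * (3 * (t - s)) := by
        rw [div_eq_mul_one_div]; exact mul_le_mul_of_nonneg_left hinv hC
      have := hf M hM
      nlinarith [mul_nonneg h0 (sub_nonneg.2 hst)]

lemma wordSum_le {r : ℝ} (hr : 0 < r) (w : List Bool) :
    ∃ C, 0 ≤ C ∧ ∀ M : ℕ, M ≠ 0 → wordSum (hurwitzWeight r) w M ≤ C / √M := by
  obtain ⟨B, hB, hu⟩ := hurwitzWeight_le hr
  induction w with
  | nil => exact ⟨0, le_rfl, fun M hM => by simp [wordSum, hM]⟩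
  | cons c w ih =>
    obtain ⟨C, hC, ih⟩ := ih
    have hw0 := wordSum_nonneg (hurwitzWeight_nonneg hr) w
    cases c with
    | true =>
      refine ⟨B * (wordSum (hurwitzWeight r) w 0 + 3 * C), by have := hw0 0; positivity,
        fun M hM => ?_⟩
      have hM' : (0 : ℝ) < M := by positivity
      refine (mul_le_mul (hu M) (sum_range_le_sqrt (hw0 0) hC ih M)
        (Finset.sum_nonneg fun a _ => hw0 a) (by positivity)).trans_eq ?_
      have h := Real.sq_sqrt hM'.le
      have hs0 : 0 < √(M : ℝ) := Real.sqrt_pos.2 hM'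
      rw [div_mul_eq_mul_div, div_eq_div_iff hM'.ne' hs0.ne']
      linear_combination B * (wordSum (hurwitzWeight r) w 0 + 3 * C) * h
    | false =>
      refine ⟨B * C, by positivity, fun M hM => ?_⟩
      have hM' : (1 : ℝ) ≤ M := by exact_mod_cast Nat.one_le_iff_ne_zero.2 hM
      rw [mul_div_assoc]
      exact mul_le_mul ((hu M).trans (div_le_self hB hM')) (ih M hM) (hw0 M) hB

lemma summable_wordSum {r : ℝ} (hr : 0 < r) (w : List Bool) :
    Summable (wordSum (hurwitzWeight r) (false :: w)) := by
  obtain ⟨B, hB, hu⟩ := hurwitzWeight_le hr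
  obtain ⟨C, hC, hw⟩ := wordSum_le hr w
  have hs : Summable fun M : ℕ => B * C * (1 / (M : ℝ) ^ (3 / 2 : ℝ)) :=
    (Real.summable_one_div_nat_rpow.2 (by norm_num)).mul_left _
  refine Summable.of_nonneg_of_le (wordSum_nonneg (hurwitzWeight_nonneg hr) _) (fun M => ?_) hs
  rcases eq_or_ne M 0 with rfl | hM
  · simp [wordSum, hurwitzWeight]
  · have hM' : (0 : ℝ) < M := by positivity
    refine (mul_le_mul (hu M) (hw M hM) (wordSum_nonneg (hurwitzWeight_nonneg hr) _ _)
      (by positivity)).trans_eq ?_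
    rw [show (3 / 2 : ℝ) = 1 + 1 / 2 by norm_num, Real.rpow_add hM', Real.rpow_one,
      ← Real.sqrt_eq_rpow]
    field_simp

end Convergence

section Words

/-- The word of an index: each entry `k` contributes `true` followed by `k - 1` times `false`. -/
def indexWord (ks : List ℕ) : List Bool :=
  ks.flatMap fun k => true :: List.replicate (k - 1) false

/-- The word of the index built from the pairs `ab`. -/
def pairWord (ab : List (ℕ × ℕ)) : List Bool :=
  ab.flatMap fun x => List.replicate x.1 true ++ List.replicate x.2 false

lemma indexWord_append (l l' : List ℕ) : indexWord (l ++ l') = indexWord l ++ indexWord l' := by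
  simp [indexWord]

lemma indexWord_replicate_one (n : ℕ) :
    indexWord (List.replicate n 1) = List.replicate n true := by
  induction n with
  | zero => rfl
  | succ n ih =>
    rw [List.replicate_succ, List.replicate_succ, ← ih]
    simp [indexWord]

lemma indexWord_indexOf {ab : List (ℕ × ℕ)} (hab : ∀ x ∈ ab, 1 ≤ x.1) :
    indexWord (indexOf ab) = pairWord ab := by
  induction ab with
  | nil => rfl
  | cons x ab ih =>
    have h : indexOf (x :: ab) = (List.replicate (x.1 - 1) 1 ++ [x.2 + 1]) ++ indexOf ab := rfl
    have h1 := hab x (by simp)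
    have h2 : List.replicate x.1 true = List.replicate (x.1 - 1) true ++ [true] := by
      rw [← List.replicate_succ', Nat.sub_add_cancel h1]
    rw [h, indexWord_append, indexWord_append, indexWord_replicate_one,
      ih fun y hy => hab y (List.mem_cons_of_mem _ hy)]
    simp [indexWord, pairWord, h2]

lemma pairWord_dual (ab : List (ℕ × ℕ)) :
    pairWord (ab.map Prod.swap).reverse = ((pairWord ab).map not).reverse := by
  induction ab with
  | nil => rfl
  | cons x ab ih =>
    simp only [pairWord, List.map_cons, List.reverse_cons, List.flatMap_append,
      List.flatMap_cons, List.flatMap_nil] at *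
    rw [ih]
    simp

lemma exists_pairWord_eq {ab : List (ℕ × ℕ)} (hne : ab ≠ [])
    (hab : ∀ x ∈ ab, 1 ≤ x.1 ∧ 1 ≤ x.2) : ∃ v, pairWord ab = true :: v ++ [false] := by
  induction ab with
  | nil => exact absurd rfl hne
  | cons x ab ih =>
    obtain ⟨⟨a, b⟩, hx⟩ : ∃ y : ℕ × ℕ, x = (y.1 + 1, y.2 + 1) :=
      ⟨(x.1 - 1, x.2 - 1), by
        have := hab x (by simp)
        ext <;> simp <;> omega⟩
    subst hx
    rcases eq_or_ne ab [] with rfl | h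
    · refine ⟨List.replicate a true ++ List.replicate b false, ?_⟩
      simp only [pairWord, List.flatMap_cons, List.flatMap_nil, List.append_nil]
      rw [List.replicate_succ, List.replicate_succ']
      simp
    · obtain ⟨v, hv⟩ := ih h fun y hy => hab y (List.mem_cons_of_mem _ hy)
      refine ⟨List.replicate a true ++ List.replicate (b + 1) false ++ true :: v, ?_⟩
      simp only [pairWord, List.flatMap_cons] at hv ⊢
      rw [hv, List.replicate_succ]
      simp

lemma one_le_of_mem_indexOf {ab : List (ℕ × ℕ)} {k : ℕ} (hk : k ∈ indexOf ab) : 1 ≤ k := by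
  simp only [indexOf, List.mem_flatMap, List.mem_append, List.mem_replicate,
    List.mem_singleton] at hk
  obtain ⟨x, -, h⟩ := hk
  omega

end Words

section Tuples

lemma wordSum_replicate_false {K : Type*} [Field K] (u : ℕ → K) (j : ℕ) (w : List Bool) (M : ℕ) :
    wordSum u (List.replicate j false ++ w) M = u M ^ j * wordSum u w M := by
  induction j with
  | zero => simp
  | succ j ih =>
    rw [List.replicate_succ, List.cons_append, wordSum, ih, pow_succ]
    ring

lemma wordSum_indexWord_ofFn_succ {K : Type*} [Field K] (u : ℕ → K) {p : ℕ} (k : Fin (p + 1) → ℕ)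
    (hk : 1 ≤ k (Fin.last p)) (M : ℕ) :
    wordSum u (indexWord (List.ofFn k)).reverse M = u M ^ k (Fin.last p) *
      ∑ a ∈ Finset.range M, wordSum u (indexWord (List.ofFn fun i => k i.castSucc)).reverse a := by
  rw [List.ofFn_succ', List.concat_eq_append, indexWord_append, List.reverse_append]
  have h : (indexWord [k (Fin.last p)]).reverse =
      List.replicate (k (Fin.last p) - 1) false ++ [true] := by
    simp [indexWord]
  rw [h, List.append_assoc, wordSum_replicate_false, List.singleton_append, wordSum, ← mul_assoc,
    ← pow_succ, Nat.sub_add_cancel hk]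

lemma strictMono_snoc_iff {p : ℕ} (m : Fin p → ℕ) (a : ℕ) :
    StrictMono (Fin.snoc m a : Fin (p + 1) → ℕ) ↔ StrictMono m ∧ ∀ i, m i < a := by
  constructor
  · intro h
    refine ⟨fun i j hij => ?_, fun i => ?_⟩
    · simpa using h (Fin.castSucc_lt_castSucc_iff.2 hij)
    · simpa using h (Fin.castSucc_lt_last i)
  · rintro ⟨h1, h2⟩ i j hij
    induction j using Fin.lastCases with
    | last =>
      induction i using Fin.lastCases with
      | last => exact absurd hij (lt_irrefl _)
      | cast i => simpa using h2 i
    | cast j =>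
      induction i using Fin.lastCases with
      | last => exact absurd hij (not_lt.2 (Fin.le_last _))
      | cast i => simpa using h1 (Fin.castSucc_lt_castSucc_iff.1 hij)

/-- The summand of the sum over strictly increasing tuples bounded by `M`. -/
@[irreducible]
def boundedTupleTerm {K : Type*} [Field K] (u : ℕ → K) {p : ℕ} (k : Fin p → ℕ) (M : ℕ)
    (m : Fin p → ℕ) : K :=
  if StrictMono m ∧ ∀ i, m i < M then ∏ i, u (m i + 1) ^ k i else 0

lemma summable_boundedTupleTerm {K : Type*} [NormedField K] (u : ℕ → K) {p : ℕ} (k : Fin p → ℕ)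
    (M : ℕ) : Summable (boundedTupleTerm u k M) := by
  refine summable_of_hasFiniteSupport
    (Set.Finite.subset (Set.Finite.pi' fun _ : Fin p => Set.finite_Iio M) fun m hm i => ?_)
  by_contra h
  rw [Function.mem_support, boundedTupleTerm, if_neg fun h' => h (h'.2 i)] at hm
  exact hm rfl

lemma boundedTupleTerm_snoc {K : Type*} [Field K] (u : ℕ → K) {p : ℕ} (k : Fin (p + 1) → ℕ)
    (M a : ℕ) (m : Fin p → ℕ) :
    boundedTupleTerm u k M (Fin.snoc m a : Fin (p + 1) → ℕ) =
      if a < M then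
        u (a + 1) ^ k (Fin.last p) * boundedTupleTerm u (fun i => k i.castSucc) a m else 0 := by
  unfold boundedTupleTerm
  simp only [strictMono_snoc_iff, Fin.forall_fin_succ', Fin.prod_univ_castSucc,
    Fin.snoc_castSucc, Fin.snoc_last]
  by_cases ha : a < M
  · by_cases hm : StrictMono m ∧ ∀ i, m i < a
    · have : ∀ i, m i < M := fun i => (hm.2 i).trans ha
      simp [ha, hm, this, mul_comm]
    · simp [ha, hm]
  · simp [ha]

lemma tsum_boundedTupleTerm {K : Type*} [NormedField K] [CompleteSpace K] (u : ℕ → K) {p : ℕ}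
    (k : Fin p → ℕ) (hk : ∀ i, 1 ≤ k i) (M : ℕ) :
    ∑' m, boundedTupleTerm u k M m =
      ∑ a ∈ Finset.range (M + 1), wordSum u (indexWord (List.ofFn k)).reverse a := by
  induction p generalizing M with
  | zero =>
    rw [tsum_eq_single default fun m hm => absurd (Subsingleton.elim _ _) hm]
    rw [boundedTupleTerm, if_pos ⟨Subsingleton.strictMono _, fun i => i.elim0⟩]
    simp [indexWord, wordSum]
  | succ p ih =>
    let e := Fin.snocEquiv fun _ : Fin (p + 1) => ℕ
    have hs : Summable fun x => boundedTupleTerm u k M (e x) :=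
      e.summable_iff.2 (summable_boundedTupleTerm u k M)
    rw [← e.tsum_eq, hs.tsum_prod]
    have h : ∀ a, ∑' m, (boundedTupleTerm u k M) (e (a, m)) =
        if a < M then wordSum u (indexWord (List.ofFn k)).reverse (a + 1) else 0 := by
      intro a
      have : ∀ m, boundedTupleTerm u k M (e (a, m)) = if a < M then
        u (a + 1) ^ k (Fin.last p) * boundedTupleTerm u (fun i => k i.castSucc) a m else 0 :=
        boundedTupleTerm_snoc u k M a
      simp_rw [this]
      split_ifs
      · rw [tsum_mul_left, ih _ fun i => hk _, wordSum_indexWord_ofFn_succ u k (hk _)]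
      · simp
    simp only [h]
    rw [(hasSum_ite_lt _ M).tsum_eq, Finset.sum_range_succ',
      wordSum_indexWord_ofFn_succ u k (hk _) 0]
    simp

lemma tsum_strictMono_eq {u : ℕ → ℂ} {u' : ℕ → ℝ} (hu : ∀ M, ‖u M‖ ≤ u' M) {h : ℕ → ℂ}
    {h' : ℕ → ℝ} (hh : ∀ M, ‖h M‖ ≤ h' M) {p : ℕ} (k : Fin (p + 1) → ℕ) (hk : ∀ i, 1 ≤ k i)
    (hs : Summable fun M => h' M * wordSum u' (indexWord (List.ofFn k)).reverse (M + 1)) :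
    (∑' m : Fin (p + 1) → ℕ, if StrictMono m then
        h (m (Fin.last p)) * ∏ i, u (m i + 1) ^ k i else 0) =
      ∑' M, h M * wordSum u (indexWord (List.ofFn k)).reverse (M + 1) := by
  have hu0 : ∀ M, 0 ≤ u' M := fun M => (norm_nonneg _).trans (hu M)
  have hh0 : ∀ M, 0 ≤ h' M := fun M => (norm_nonneg _).trans (hh M)
  let e := Fin.snocEquiv fun _ : Fin (p + 1) => ℕ
  obtain ⟨k₀, hk₀⟩ : ∃ k₀ : Fin p → ℕ, k₀ = fun i => k i.castSucc := ⟨_, rfl⟩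
  have hk₀' : ∀ i, 1 ≤ k₀ i := fun i => hk₀ ▸ hk _
  have hterm : ∀ x : ℕ × (Fin p → ℕ), (if StrictMono (e x) then
      h (e x (Fin.last p)) * ∏ i, u (e x i + 1) ^ k i else 0) =
      h x.1 * u (x.1 + 1) ^ k (Fin.last p) * boundedTupleTerm u k₀ x.1 x.2 := by
    rintro ⟨a, m⟩
    have : e (a, m) = (Fin.snoc m a : Fin (p + 1) → ℕ) := rfl
    simp only [hk₀, this, boundedTupleTerm, strictMono_snoc_iff, Fin.prod_univ_castSucc,
      Fin.snoc_castSucc, Fin.snoc_last]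
    split_ifs
    · ring
    · simp
  have hb0 : ∀ a m, 0 ≤ boundedTupleTerm u' k₀ a m := fun a m => by
    unfold boundedTupleTerm
    split_ifs
    · exact Finset.prod_nonneg fun i _ => pow_nonneg (hu0 _) _
    · exact le_rfl
  have hb : ∀ a m, ‖boundedTupleTerm u k₀ a m‖ ≤ boundedTupleTerm u' k₀ a m := fun a m => by
    unfold boundedTupleTerm
    split_ifs
    · rw [norm_prod]
      refine Finset.prod_le_prod (fun _ _ => norm_nonneg _) fun i _ => ?_
      rw [norm_pow]
      exact pow_le_pow_left₀ (norm_nonneg _) (hu _) _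
    · simp
  have hsum : ∀ a, h a * u (a + 1) ^ k (Fin.last p) * ∑' m, boundedTupleTerm u k₀ a m =
      h a * wordSum u (indexWord (List.ofFn k)).reverse (a + 1) := fun a => by
    rw [tsum_boundedTupleTerm u k₀ hk₀', hk₀, wordSum_indexWord_ofFn_succ u k (hk _),
      mul_assoc]
  have hsum' : ∀ a, h' a * u' (a + 1) ^ k (Fin.last p) * ∑' m, boundedTupleTerm u' k₀ a m =
      h' a * wordSum u' (indexWord (List.ofFn k)).reverse (a + 1) := fun a => by
    rw [tsum_boundedTupleTerm u' k₀ hk₀', hk₀, wordSum_indexWord_ofFn_succ u' k (hk _),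
      mul_assoc]
  have hsr : Summable fun x : ℕ × (Fin p → ℕ) =>
      h' x.1 * u' (x.1 + 1) ^ k (Fin.last p) * boundedTupleTerm u' k₀ x.1 x.2 := by
    rw [summable_prod_of_nonneg fun x => mul_nonneg
      (mul_nonneg (hh0 _) (pow_nonneg (hu0 _) _)) (hb0 _ _)]
    refine ⟨fun a => Summable.mul_left (h' a * u' (a + 1) ^ k (Fin.last p))
      (summable_boundedTupleTerm u' k₀ a), ?_⟩
    simp_rw [tsum_mul_left, hsum']
    exact hs
  have hsc : Summable fun x : ℕ × (Fin p → ℕ) =>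
      h x.1 * u (x.1 + 1) ^ k (Fin.last p) * boundedTupleTerm u k₀ x.1 x.2 := by
    refine Summable.of_norm_bounded hsr fun x => ?_
    rw [norm_mul, norm_mul, norm_pow]
    exact mul_le_mul (mul_le_mul (hh _) (pow_le_pow_left₀ (norm_nonneg _) (hu _) _)
      (by positivity) (hh0 _)) (hb _ _) (norm_nonneg _)
      (mul_nonneg (hh0 _) (pow_nonneg (hu0 _) _))
  rw [← e.tsum_eq]
  simp_rw [hterm]
  rw [hsc.tsum_prod]
  simp_rw [tsum_mul_left, hsum]

end Tuples

section Boundary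

variable {K : Type*} [Field K] (α : K)

lemma connectedTerm_nil_right (w : List Bool) (M : ℕ) :
    connectedTerm α w [] (M, 0) = wordSum (hurwitzWeight α) w M := by
  simp [connectedTerm, wordSum, connector_zero_right]

lemma connectedTerm_nil_left (w : List Bool) (n : ℕ) :
    connectedTerm α [] w (0, n) = connector α 0 n * wordSum (hurwitzWeight 1) w n := by
  simp [connectedTerm, wordSum]

lemma support_connectedTerm_nil_right {w : List Bool} (hw : w ≠ []) :
    Function.support (connectedTerm α w []) ⊆ Set.range fun M : ℕ => (M + 1, 0) := by
  rintro ⟨M, n⟩ h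
  rcases eq_or_ne n 0 with rfl | hn
  · cases M with
    | zero => simp [connectedTerm, wordSum_zero (u := hurwitzWeight α) rfl hw] at h
    | succ M => exact ⟨M, rfl⟩
  · simp [connectedTerm, wordSum, hn] at h

lemma support_connectedTerm_nil_left {w : List Bool} (hw : w ≠ []) :
    Function.support (connectedTerm α [] w) ⊆ Set.range fun n : ℕ => (0, n + 1) := by
  rintro ⟨M, n⟩ h
  rcases eq_or_ne M 0 with rfl | hM
  · cases n with
    | zero => simp [connectedTerm, wordSum_zero (u := hurwitzWeight (1 : K)) rfl hw] at h
    | succ n => exact ⟨n, rfl⟩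
  · simp [connectedTerm, wordSum, hM] at h

lemma connector_zero_left (n : ℕ) :
    connector α 0 n = (n.factorial : K) / (ascPochhammer K n).eval α := by
  induction n with
  | zero => simp [connector]
  | succ n ih =>
    rw [connector_succ_right, ih, ascPochhammer_succ_eval, Nat.factorial_succ]
    push_cast
    rw [zero_add, div_mul_div_comm, add_comm α, mul_comm (n.factorial : K)]

end Boundary

theorem stmt16 (ab : List (ℕ × ℕ)) (hne : ab ≠ [])
    (hab : ∀ x ∈ ab, 1 ≤ x.1 ∧ 1 ≤ x.2)
    (p q : ℕ) (k : Fin (p + 1) → ℕ) (k' : Fin (q + 1) → ℕ)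
    (hk : List.ofFn k = indexOf ab) (hk' : List.ofFn k' = dualIndexOf ab)
    (α : ℂ) (hα : 0 < α.re) :
    mhz α k
    = ∑' m : Fin (q + 1) → ℕ, if StrictMono m then
        ((Nat.factorial (m (Fin.last q) + 1) : ℂ)
            / (ascPochhammer ℂ (m (Fin.last q) + 1)).eval α)
          * ∏ i, (1 : ℂ) / (((m i : ℂ) + 1) ^ (k' i))
      else 0 := by
  have hk1 : ∀ i, 1 ≤ k i := fun i =>
    one_le_of_mem_indexOf (hk ▸ List.mem_ofFn.2 ⟨i, rfl⟩ : k i ∈ indexOf ab)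
  have hk1' : ∀ i, 1 ≤ k' i := fun i =>
    one_le_of_mem_indexOf (hk' ▸ List.mem_ofFn.2 ⟨i, rfl⟩ : k' i ∈ dualIndexOf ab)
  obtain ⟨v, hv⟩ := exists_pairWord_eq hne hab
  have hw : (indexWord (List.ofFn k)).reverse = false :: v.reverse ++ [true] := by
    rw [hk, indexWord_indexOf fun x hx => (hab x hx).1, hv]
    simp
  have hw' : (indexWord (List.ofFn k')).reverse =
      ((false :: v.reverse ++ [true]).map not).reverse := by
    have hab' : ∀ x ∈ (ab.map Prod.swap).reverse, 1 ≤ x.1 := by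
      intro x hx
      simp only [List.mem_reverse, List.mem_map] at hx
      obtain ⟨y, hy, rfl⟩ := hx
      exact (hab y hy).2
    rw [hk', dualIndexOf, indexWord_indexOf hab', pairWord_dual, hv]
    simp
  have hinj : Function.Injective fun M : ℕ => (M + 1, 0) := fun a b hab => by simpa using hab
  have hinj' : Function.Injective fun n : ℕ => (0, n + 1) := fun a b hab => by simpa using hab
  have hne1 : false :: v.reverse ++ [true] ≠ [] := by simp
  have hne2 : ((false :: v.reverse ++ [true]).map not).reverse ≠ [] := by simp
  have hs1 : Summable fun M =>
      wordSum (hurwitzWeight α.re) (false :: v.reverse ++ [true]) (M + 1) :=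
    (summable_nat_add_iff 1).2 (summable_wordSum hα _)
  have hs : Summable (connectedTerm α.re (false :: v.reverse ++ [true]) []) := by
    rw [← hinj.summable_iff fun x hx => Function.notMem_support.1 fun h =>
      hx (support_connectedTerm_nil_right _ hne1 h)]
    simpa only [Function.comp_def, connectedTerm_nil_right] using hs1
  obtain ⟨hs', hdual⟩ := connectedSum_duality hα v.reverse hs
  have hs2 : Summable fun n => connector α.re 0 (n + 1) *
      wordSum (hurwitzWeight 1) ((false :: v.reverse ++ [true]).map not).reverse (n + 1) := by
    rw [← hinj'.summable_iff fun x hx => Function.notMem_support.1 fun h =>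
      hx (support_connectedTerm_nil_left _ hne2 h)] at hs'
    simpa only [Function.comp_def, connectedTerm_nil_left] using hs'
  rw [← hinj.tsum_eq (support_connectedTerm_nil_right _ hne1),
    ← hinj'.tsum_eq (support_connectedTerm_nil_left _ hne2)] at hdual
  simp only [connectedTerm_nil_right, connectedTerm_nil_left] at hdual
  rw [← hw', ← hw] at hdual
  have hL := tsum_strictMono_eq (norm_hurwitzWeight_le hα) (h := fun _ => 1) (h' := fun _ => 1)
    (fun _ => by simp) k hk1 (by simpa only [one_mul, hw] using hs1)
  have hR := tsum_strictMono_eq norm_hurwitzWeight_one_le (h := fun n => connector α 0 (n + 1))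
    (fun n => norm_connector_le hα 0 (n + 1)) k' hk1' (by simpa only [hw'] using hs2)
  simp only [one_mul] at hL
  rw [← hL, ← hR] at hdual
  convert hdual using 1
  · refine tsum_congr fun m => ?_
    simp only [hurwitzWeight, one_div_pow]
  · refine tsum_congr fun m => ?_
    simp only [hurwitzWeight, one_div_pow, connector_zero_left]
end

section
/- For s ≥ 1 and complex α with Re(α) > 0, Σ_{m≥0} [m!/(α)_{m+1}] (2m+α+1)(-1)^m/((m+α)^s (m+1)^s) = Σ_{0≤m₁≤⋯≤m_s<∞} 1/(m₁+α)² · Π_{i=2}^s 1/((mᵢ+α)(mᵢ+1)). -/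
open scoped BigOperators

namespace AlternatingPochhammerSum

open Finset Filter Topology

/-- The ratio `m! / (α)_{m+1}`. -/
noncomputable def factorialRatio (α : ℂ) (m : ℕ) : ℂ :=
  (Nat.factorial m : ℂ) / (ascPochhammer ℂ (m + 1)).eval α

/-- The coefficient of `1 / ((m + α) (m + 1)) ^ s` in the alternating series. -/
noncomputable def coeff (α : ℂ) (m : ℕ) : ℂ :=
  factorialRatio α m * (2 * m + α + 1) * (-1 : ℂ) ^ m

/-- The factor which turns `coeff α m` into the coefficient of the series truncated at `N`.
It vanishes for `N < m` and tends to `1` as `N` grows. -/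
noncomputable def damping (α : ℂ) (m N : ℕ) : ℂ :=
  ∏ j ∈ range (m + 1), ((N : ℂ) + 1 - j) / ((N : ℂ) + 1 + α + j)

/-- The truncated alternating sum. -/
noncomputable def alternatingSum (α : ℂ) (s N : ℕ) : ℂ :=
  ∑ m ∈ range (N + 1), coeff α m * damping α m N / (((m : ℂ) + α) * ((m : ℂ) + 1)) ^ s

/-- The sum of `∏ i, w i (m i)` over monotone `m : Fin s → ℕ` with values at most `N`. -/
noncomputable def monotoneSum (w : ℕ → ℕ → ℂ) (s N : ℕ) : ℂ :=
  open Classical in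
  ∑ m ∈ Fintype.piFinset (fun _ : Fin s => range (N + 1)),
    if Monotone m then ∏ i : Fin s, w i (m i) else 0

/-- The weight of the multiple series. -/
noncomputable def weight (α : ℂ) (i n : ℕ) : ℂ :=
  if i = 0 then (1 : ℂ) / (((n : ℂ) + α) ^ 2) else (1 : ℂ) / (((n : ℂ) + α) * ((n : ℂ) + 1))

section Algebra

variable {α : ℂ}

lemma add_ne_zero_of_re_pos (hα : 0 < α.re) {x : ℝ} (hx : 0 ≤ x) : (x : ℂ) + α ≠ 0 := by
  intro h
  have := congrArg Complex.re h
  simp at this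
  linarith

lemma natCast_add_ne_zero (hα : 0 < α.re) (n : ℕ) : (n : ℂ) + α ≠ 0 := by
  simpa using add_ne_zero_of_re_pos hα (Nat.cast_nonneg (α := ℝ) n)

lemma factorialRatio_zero : factorialRatio α 0 = 1 / α := by
  simp [factorialRatio]

lemma factorialRatio_succ (m : ℕ) :
    factorialRatio α (m + 1) = factorialRatio α m * (((m : ℂ) + 1) / ((m : ℂ) + 1 + α)) := by
  unfold factorialRatio
  rw [ascPochhammer_succ_eval (n := m + 1), Nat.factorial_succ, div_mul_div_comm]
  push_cast
  ring

lemma damping_succ (m N : ℕ) :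
    damping α (m + 1) N
      = damping α m N * (((N : ℂ) + 1 - (m + 1)) / ((N : ℂ) + 1 + α + (m + 1))) := by
  unfold damping
  rw [prod_range_succ (n := m + 1)]
  push_cast
  rfl

lemma damping_succ_self (N : ℕ) : damping α (N + 1) N = 0 := by
  rw [damping_succ]; simp

lemma damping_recurrence (hα : 0 < α.re) (m N : ℕ) :
    damping α m (N + 1) * (((N : ℂ) + 1 - m) * ((N : ℂ) + m + 2 + α))
      = damping α m N * (((N : ℂ) + 1 + α) * ((N : ℂ) + 2)) := by
  induction m with
  | zero =>
    have h1 := natCast_add_ne_zero hα (N + 1)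
    have h2 := natCast_add_ne_zero hα (N + 2)
    push_cast at h1 h2
    have h3 : (N : ℂ) + 1 + 1 + α ≠ 0 := by convert h2 using 1; ring
    simp only [damping, zero_add, range_one, prod_singleton]
    push_cast
    simp only [add_zero, sub_zero]
    field_simp
    ring
  | succ m ih =>
    have h1 := natCast_add_ne_zero hα (N + m + 3)
    have h2 := natCast_add_ne_zero hα (N + m + 2)
    push_cast at h1 h2
    have h3 : (N : ℂ) + 1 + 1 + α + (m + 1) ≠ 0 := by convert h1 using 1; ring
    have h4 : (N : ℂ) + 1 + α + (m + 1) ≠ 0 := by convert h2 using 1; ring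
    rw [damping_succ, damping_succ]
    push_cast
    field_simp
    linear_combination ((N : ℂ) - m) * ((N : ℂ) + m + 3 + α) * ih

lemma sum_coeff_mul_damping_range (hα : 0 < α.re) (N k : ℕ) :
    ∑ m ∈ range k, coeff α m * damping α m N
      = ((N : ℂ) + 1) / ((N : ℂ) + α)
        - (α + k) * (α + 1 + N + k) * (-1) ^ k * factorialRatio α k * damping α k N
          / ((N : ℂ) + α) := by
  have h0 := natCast_add_ne_zero hα N
  induction k with
  | zero =>
    have h1 := natCast_add_ne_zero hα (N + 1)
    have h2 := natCast_add_ne_zero hα 0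
    push_cast at h1 h2
    rw [zero_add] at h2
    simp only [damping, factorialRatio_zero, zero_add, range_one, prod_singleton, range_zero,
      sum_empty]
    push_cast
    simp only [add_zero, sub_zero]
    field_simp
    ring
  | succ k ih =>
    have h1 := natCast_add_ne_zero hα (N + k + 2)
    have h2 := natCast_add_ne_zero hα (k + 1)
    push_cast at h1 h2
    have h3 : (N : ℂ) + 1 + α + (k + 1) ≠ 0 := by convert h1 using 1; ring
    rw [sum_range_succ, ih, damping_succ, factorialRatio_succ, coeff]
    push_cast
    field_simp
    ring

lemma alternatingSum_zero (hα : 0 < α.re) (N : ℕ) :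
    alternatingSum α 0 N = ((N : ℂ) + 1) / ((N : ℂ) + α) := by
  simp only [alternatingSum, pow_zero, div_one]
  rw [sum_coeff_mul_damping_range hα, damping_succ_self]
  simp

lemma alternatingSum_succ (hα : 0 < α.re) (s N : ℕ) :
    alternatingSum α (s + 1) N
      = ∑ n ∈ range (N + 1), alternatingSum α s n * (1 / (((n : ℂ) + α) * ((n : ℂ) + 1))) := by
  have hne : ∀ n : ℕ, ((n : ℂ) + α) * ((n : ℂ) + 1) ≠ 0 := fun n =>
    mul_ne_zero (natCast_add_ne_zero hα n) (Nat.cast_add_one_ne_zero n)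
  induction N with
  | zero =>
    simp only [alternatingSum, zero_add, range_one, sum_singleton]
    rw [pow_succ, div_mul_div_comm, mul_one]
  | succ N ih =>
    rw [sum_range_succ, ← ih]
    have hext : alternatingSum α (s + 1) N = ∑ m ∈ range (N + 1 + 1),
        coeff α m * damping α m N / (((m : ℂ) + α) * ((m : ℂ) + 1)) ^ (s + 1) := by
      rw [sum_range_succ, damping_succ_self]
      simp [alternatingSum]
    rw [hext, alternatingSum, alternatingSum, sum_mul, ← sum_add_distrib]
    refine sum_congr rfl fun m _ => ?_
    have hm := hne m
    have hN := hne (N + 1)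
    have hrec := damping_recurrence hα m N
    generalize hA : ((m : ℂ) + α) * ((m : ℂ) + 1) = A at *
    generalize hB : (((N + 1 : ℕ) : ℂ) + α) * (((N + 1 : ℕ) : ℂ) + 1) = B at *
    have hrec' : damping α m (N + 1) * (B - A) = damping α m N * B := by
      rw [← hA, ← hB]
      push_cast
      linear_combination hrec
    field_simp
    linear_combination coeff α m * A ^ s * hrec'

end Algebra

section Combinatorics

lemma monotone_snoc_iff {s : ℕ} (q : Fin s → ℕ) (n : ℕ) :
    Monotone (Fin.snoc q n : Fin (s + 1) → ℕ) ↔ Monotone q ∧ ∀ i, q i ≤ n := by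
  constructor
  · intro h
    refine ⟨fun i j hij => ?_, fun i => ?_⟩
    · simpa using h (Fin.castSucc_le_castSucc_iff.2 hij)
    · simpa using h (Fin.castSucc_lt_last i).le
  · rintro ⟨h, hn⟩ i j hij
    induction j using Fin.lastCases with
    | last =>
      induction i using Fin.lastCases with
      | last => rfl
      | cast i => simpa using hn i
    | cast j =>
      induction i using Fin.lastCases with
      | last => exact absurd hij (Fin.castSucc_lt_last j).not_ge
      | cast i => simpa using h (Fin.castSucc_le_castSucc_iff.1 hij)

lemma sum_piFinset_snoc {M β : Type*} [AddCommMonoid M] [DecidableEq β] (s : ℕ) (t : Finset β)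
    (F : (Fin (s + 1) → β) → M) :
    ∑ p ∈ Fintype.piFinset (fun _ : Fin (s + 1) => t), F p
      = ∑ n ∈ t, ∑ q ∈ Fintype.piFinset (fun _ : Fin s => t), F (Fin.snoc q n) := by
  rw [← sum_product']
  refine sum_nbij' (fun p => (p (Fin.last s), Fin.init p)) (fun x => Fin.snoc x.2 x.1)
    ?_ ?_ ?_ ?_ ?_
  · intro p hp
    simp only [Fintype.mem_piFinset, mem_product] at hp ⊢
    exact ⟨hp _, fun i => hp _⟩
  · intro x hx
    simp only [Fintype.mem_piFinset, mem_product] at hx ⊢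
    intro i
    induction i using Fin.lastCases with
    | last => simpa using hx.1
    | cast i => simpa using hx.2 i
  · intro p _; simp
  · intro x _; simp
  · intro p _; simp

lemma monotoneSum_zero (w : ℕ → ℕ → ℂ) (N : ℕ) : monotoneSum w 0 N = 1 := by
  simp [monotoneSum, Subsingleton.monotone]

lemma monotoneSum_succ (w : ℕ → ℕ → ℂ) (s N : ℕ) :
    monotoneSum w (s + 1) N = ∑ n ∈ range (N + 1), monotoneSum w s n * w s n := by
  classical
  unfold monotoneSum
  rw [sum_piFinset_snoc]
  refine sum_congr rfl fun n hn => ?_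
  rw [sum_mul]
  symm
  refine sum_subset_zero_on_sdiff (Fintype.piFinset_subset _ _ fun _ => ?_) ?_ ?_
  · exact range_subset_range.2 (mem_range.1 hn)
  · intro q hq
    rw [if_neg]
    rw [monotone_snoc_iff]
    rintro ⟨-, h⟩
    refine (mem_sdiff.1 hq).2 (Fintype.mem_piFinset.2 fun i => ?_)
    exact mem_range.2 (Nat.lt_succ_of_le (h i))
  · intro q hq
    have hle : ∀ i, q i ≤ n := fun i =>
      Nat.le_of_lt_succ (mem_range.1 (Fintype.mem_piFinset.1 hq i))
    simp only [monotone_snoc_iff, hle, implies_true, and_true]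
    split_ifs
    · rw [Fin.prod_univ_castSucc]; simp
    · simp

lemma alternatingSum_eq_monotoneSum {α : ℂ} (hα : 0 < α.re) (s N : ℕ) :
    alternatingSum α (s + 1) N = monotoneSum (weight α) (s + 1) N := by
  induction s generalizing N with
  | zero =>
    rw [alternatingSum_succ hα, monotoneSum_succ]
    refine sum_congr rfl fun n _ => ?_
    have h1 := natCast_add_ne_zero hα n
    have h2 : (n : ℂ) + 1 ≠ 0 := Nat.cast_add_one_ne_zero n
    rw [alternatingSum_zero hα, monotoneSum_zero, weight, if_pos rfl]
    field_simp
  | succ s ih =>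
    rw [alternatingSum_succ hα, monotoneSum_succ]
    refine sum_congr rfl fun n _ => ?_
    rw [ih, weight, if_neg (Nat.succ_ne_zero s)]

end Combinatorics

section Analysis

variable {α : ℂ}

lemma add_re_le_norm (α : ℂ) (x : ℝ) : x + α.re ≤ ‖(x : ℂ) + α‖ := by
  simpa using Complex.re_le_norm ((x : ℂ) + α)

/-- If `f` has nonnegative values and `g n ≤ f n - f (n + 1)` then `g` is summable. -/
lemma summable_of_le_sub_succ {f g : ℕ → ℝ} (hf : ∀ n, 0 ≤ f n) (hg : ∀ n, 0 ≤ g n)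
    (h : ∀ n, g n ≤ f n - f (n + 1)) : Summable g := by
  refine summable_of_sum_range_le (c := f 0) hg fun n => ?_
  calc ∑ i ∈ range n, g i ≤ ∑ i ∈ range n, (f i - f (i + 1)) := sum_le_sum fun i _ => h i
    _ = f 0 - f n := sum_range_sub' f n
    _ ≤ f 0 := by linarith [hf n]

lemma exists_inv_norm_le (hα : 0 < α.re) :
    ∃ K : ℝ, 0 < K ∧ ∀ n : ℕ, ‖(n : ℂ) + α‖⁻¹ ≤ K * ((n : ℝ) + 1)⁻¹ := by
  refine ⟨1 + α.re⁻¹, by positivity, fun n => ?_⟩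
  have h1 : (n : ℝ) + α.re ≤ ‖(n : ℂ) + α‖ := by simpa using add_re_le_norm α n
  have h2 : 0 < (n : ℝ) + α.re := by positivity
  refine (inv_anti₀ h2 h1).trans ?_
  rw [← div_eq_mul_inv, inv_eq_one_div, div_le_div_iff₀ h2 (by positivity)]
  have h3 : α.re⁻¹ * α.re = 1 := inv_mul_cancel₀ hα.ne'
  have h4 : 0 ≤ α.re⁻¹ * n := by positivity
  nlinarith

lemma summable_inv_succ_sq : Summable fun n : ℕ => ((n : ℝ) + 1)⁻¹ * ((n : ℝ) + 1)⁻¹ := by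
  have h := (summable_nat_add_iff 1).2 (Real.summable_nat_pow_inv.2 (one_lt_two))
  refine h.congr fun n => ?_
  push_cast
  rw [pow_two, mul_inv]

lemma summable_norm_weight (hα : 0 < α.re) (i : ℕ) : Summable fun n => ‖weight α i n‖ := by
  obtain ⟨K, hK, h⟩ := exists_inv_norm_le hα
  have hn : ∀ n : ℕ, ‖(n : ℂ) + 1‖ = n + 1 := fun n => by
    rw [← Nat.cast_succ, Complex.norm_natCast, Nat.cast_succ]
  by_cases hi : i = 0
  · refine Summable.of_nonneg_of_le (fun _ => norm_nonneg _) (fun n => ?_)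
      (summable_inv_succ_sq.mul_left (K * K))
    rw [weight, if_pos hi, one_div, norm_inv, norm_pow, pow_two, mul_inv]
    calc _ ≤ (K * ((n : ℝ) + 1)⁻¹) * (K * ((n : ℝ) + 1)⁻¹) := by gcongr <;> exact h n
      _ = _ := by ring
  · refine Summable.of_nonneg_of_le (fun _ => norm_nonneg _) (fun n => ?_)
      (summable_inv_succ_sq.mul_left K)
    rw [weight, if_neg hi, one_div, norm_inv, norm_mul, mul_inv, hn, ← mul_assoc]
    gcongr
    exact h n

lemma tendsto_monotoneSum [∀ s, DecidablePred (Monotone : (Fin s → ℕ) → Prop)]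
    {w : ℕ → ℕ → ℂ} (hw : ∀ i, Summable fun n => ‖w i n‖) (s : ℕ) :
    Tendsto (monotoneSum w s) atTop
      (𝓝 (∑' m : Fin s → ℕ, if Monotone m then ∏ i : Fin s, w i (m i) else 0)) := by
  have hbox : ∀ u : Finset (Fin s → ℕ), ∃ N : ℕ, ∀ n ≥ N,
      u ⊆ Fintype.piFinset (fun _ : Fin s => range (n + 1)) := by
    intro u
    refine ⟨u.sup fun p => univ.sup p, fun n hn p hp => Fintype.mem_piFinset.2 fun i => ?_⟩
    refine mem_range.2 (Nat.lt_succ_of_le (le_trans ?_ hn))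
    exact (le_sup (f := p) (mem_univ i)).trans (le_sup (f := fun p => univ.sup p) hp)
  have hprod : Summable fun m : Fin s → ℕ => ∏ i : Fin s, ‖w i (m i)‖ := by
    refine summable_of_sum_le (c := ∏ i : Fin s, ∑' n, ‖w i n‖)
      (fun m => prod_nonneg fun i _ => norm_nonneg _) fun u => ?_
    obtain ⟨N, hN⟩ := hbox u
    calc _ ≤ ∑ m ∈ Fintype.piFinset (fun _ : Fin s => range (N + 1)), ∏ i : Fin s, ‖w i (m i)‖ :=
          sum_le_sum_of_subset_of_nonneg (hN N le_rfl)
            fun m _ _ => prod_nonneg fun i _ => norm_nonneg _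
      _ = ∏ i : Fin s, ∑ n ∈ range (N + 1), ‖w i n‖ := by
          rw [prod_univ_sum]
      _ ≤ _ := prod_le_prod (fun i _ => sum_nonneg fun _ _ => norm_nonneg _)
          fun i _ => (hw i).sum_le_tsum _ fun _ _ => norm_nonneg _
  have hsum : Summable fun m : Fin s → ℕ =>
      if Monotone m then ∏ i : Fin s, w i (m i) else 0 := by
    refine Summable.of_norm_bounded hprod fun m => ?_
    split_ifs
    · rw [norm_prod]
    · rw [norm_zero]; exact prod_nonneg fun i _ => norm_nonneg _
  have hlim : Tendsto (fun N : ℕ => Fintype.piFinset (fun _ : Fin s => range (N + 1)))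
      atTop atTop := by
    refine tendsto_atTop.2 fun u => ?_
    obtain ⟨N, hN⟩ := hbox u
    exact eventually_atTop.2 ⟨N, hN⟩
  refine (hsum.hasSum.comp hlim).congr fun N => ?_
  simp only [Function.comp_def, monotoneSum]
  refine sum_congr rfl fun m _ => ?_
  congr

lemma norm_damping_le_one (hα : 0 < α.re) (m N : ℕ) : ‖damping α m N‖ ≤ 1 := by
  rw [damping, norm_prod]
  refine prod_le_one (fun _ _ => norm_nonneg _) fun j _ => ?_
  rw [norm_div]
  have h1 : (N : ℝ) + 1 + j + α.re ≤ ‖(N : ℂ) + 1 + α + j‖ := by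
    have := add_re_le_norm α ((N : ℝ) + 1 + j)
    push_cast at this
    rwa [show (N : ℂ) + 1 + α + j = (N : ℂ) + 1 + j + α by ring]
  have h2 : ‖(N : ℂ) + 1 - j‖ ≤ (N : ℝ) + 1 + j := by
    refine (norm_sub_le _ _).trans ?_
    rw [← Nat.cast_succ, Complex.norm_natCast, Complex.norm_natCast, Nat.cast_succ]
  exact div_le_one_of_le₀ (by linarith) (norm_nonneg _)

lemma tendsto_damping (m : ℕ) : Tendsto (damping α m) atTop (𝓝 1) := by
  have h : ∀ j ∈ range (m + 1), Tendsto
      (fun N : ℕ => ((N : ℂ) + 1 - j) / ((N : ℂ) + 1 + α + j)) atTop (𝓝 1) := by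
    intro j _
    have := tendsto_add_mul_div_add_mul_atTop_nhds (𝕜 := ℂ) (1 - j) (1 + α + j) 1 one_ne_zero
    rw [div_one] at this
    refine this.congr fun N => ?_
    congr 1 <;> ring
  rw [← prod_const_one (s := range (m + 1))]
  exact tendsto_finsetProd _ h

/-- A majorant of `factorialRatio`, proportional to `m! / (σ)_{m+1}` with `σ = re α`. -/
lemma exists_majorant_factorialRatio (hα : 0 < α.re) :
    ∃ b : ℕ → ℝ, (∀ m, ‖factorialRatio α m‖ ≤ b m) ∧
      ∀ m, b (m + 1) = b m * (((m : ℝ) + 1) / ((m : ℝ) + 1 + α.re)) := by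
  refine ⟨fun m => ‖factorialRatio α 0‖ *
    ∏ j ∈ range m, (((j : ℝ) + 1) / ((j : ℝ) + 1 + α.re)), fun m => ?_, fun m => ?_⟩
  · induction m with
    | zero => simp
    | succ m ih =>
      beta_reduce at ih ⊢
      rw [factorialRatio_succ, norm_mul, prod_range_succ, ← mul_assoc]
      have h1 : (m : ℝ) + 1 + α.re ≤ ‖(m : ℂ) + 1 + α‖ := by
        simpa using add_re_le_norm α ((m : ℝ) + 1)
      have h2 : ‖(m : ℂ) + 1‖ = m + 1 := by
        rw [← Nat.cast_succ, Complex.norm_natCast, Nat.cast_succ]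
      have h3 : 0 < (m : ℝ) + 1 + α.re := by positivity
      refine mul_le_mul ih ?_ (norm_nonneg _) ((norm_nonneg _).trans ih)
      rw [norm_div, h2]
      gcongr
  · simp only [prod_range_succ, mul_assoc]

lemma summable_norm_factorialRatio_div (hα : 0 < α.re) :
    Summable fun m : ℕ => ‖factorialRatio α m‖ * ((m : ℝ) + 1)⁻¹ := by
  obtain ⟨b, hb, hrec⟩ := exists_majorant_factorialRatio hα
  have hb0 : ∀ m, 0 ≤ b m := fun m => (norm_nonneg _).trans (hb m)
  have hs : Summable fun m : ℕ => α.re * b m / ((m : ℝ) + 1 + α.re) := by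
    refine summable_of_le_sub_succ hb0
      (fun n => div_nonneg (mul_nonneg hα.le (hb0 n)) (by positivity)) fun n => ?_
    have : (n : ℝ) + 1 + α.re ≠ 0 := by positivity
    rw [hrec]
    apply le_of_eq
    field_simp
    ring
  refine Summable.of_nonneg_of_le (fun m => by positivity) (fun m => ?_)
    (hs.mul_left ((1 + α.re) / α.re))
  have h3 : 0 < (m : ℝ) + 1 + α.re := by positivity
  calc ‖factorialRatio α m‖ * ((m : ℝ) + 1)⁻¹ ≤ b m * ((m : ℝ) + 1)⁻¹ := by
        gcongr; exact hb m
    _ ≤ b m * ((1 + α.re) / ((m : ℝ) + 1 + α.re)) := by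
        refine mul_le_mul_of_nonneg_left ?_ (hb0 m)
        rw [inv_eq_one_div, div_le_div_iff₀ (by positivity) h3]
        have : 0 ≤ α.re * m := by positivity
        nlinarith
    _ = _ := by field_simp

lemma summable_norm_coeff_div (hα : 0 < α.re) (s : ℕ) :
    Summable fun m : ℕ => ‖coeff α m / (((m : ℂ) + α) * ((m : ℂ) + 1)) ^ (s + 1)‖ := by
  obtain ⟨K, hK, h⟩ := exists_inv_norm_le hα
  have hn : ∀ n : ℕ, ‖(n : ℂ) + 1‖ = n + 1 := fun n => by
    rw [← Nat.cast_succ, Complex.norm_natCast, Nat.cast_succ]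
  have hinv : ∀ m : ℕ, ((m : ℝ) + 1)⁻¹ ≤ 1 := fun m => inv_le_one_of_one_le₀ (by simp)
  refine Summable.of_nonneg_of_le (fun _ => norm_nonneg _) (fun m => ?_)
    ((summable_norm_factorialRatio_div hα).mul_left ((1 + K) * K ^ s))
  have hA : ((m : ℂ) + α) ≠ 0 := natCast_add_ne_zero hα m
  have hB : ((m : ℂ) + 1) ≠ 0 := Nat.cast_add_one_ne_zero m
  have hsplit : coeff α m / (((m : ℂ) + α) * ((m : ℂ) + 1)) ^ (s + 1)
      = factorialRatio α m * (-1) ^ m * (((m : ℂ) + 1)⁻¹ + ((m : ℂ) + α)⁻¹)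
        * (((m : ℂ) + α)⁻¹ * ((m : ℂ) + 1)⁻¹) ^ s := by
    rw [coeff, ← mul_inv, inv_pow, pow_succ]
    field_simp
    ring
  rw [hsplit, norm_mul, norm_mul, norm_mul, norm_pow, norm_pow, norm_neg, norm_one, one_pow,
    mul_one, norm_mul, norm_inv, norm_inv, hn]
  have h1 : ‖((m : ℂ) + 1)⁻¹ + ((m : ℂ) + α)⁻¹‖ ≤ (1 + K) * ((m : ℝ) + 1)⁻¹ := by
    refine (norm_add_le _ _).trans ?_
    rw [norm_inv, norm_inv, hn]
    linarith [h m]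
  have h2 : ‖(m : ℂ) + α‖⁻¹ * ((m : ℝ) + 1)⁻¹ ≤ K := by
    calc _ ≤ (K * 1) * 1 := by
          gcongr
          · exact (h m).trans (by gcongr; exact hinv m)
          · exact hinv m
      _ = K := by ring
  calc _ ≤ ‖factorialRatio α m‖ * ((1 + K) * ((m : ℝ) + 1)⁻¹) * K ^ s := by gcongr
    _ = _ := by ring

lemma tendsto_alternatingSum (hα : 0 < α.re) (s : ℕ) :
    Tendsto (alternatingSum α (s + 1)) atTop
      (𝓝 (∑' m : ℕ, coeff α m / (((m : ℂ) + α) * ((m : ℂ) + 1)) ^ (s + 1))) := by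
  have hzero : ∀ N m : ℕ, N < m → damping α m N = 0 := by
    intro N m hm
    refine prod_eq_zero (mem_range.2 (Nat.succ_lt_succ hm)) ?_
    push_cast
    simp
  have hfin : ∀ N, alternatingSum α (s + 1) N = ∑' m : ℕ,
      coeff α m / (((m : ℂ) + α) * ((m : ℂ) + 1)) ^ (s + 1) * damping α m N := by
    intro N
    rw [tsum_eq_sum (s := range (N + 1))]
    · exact sum_congr rfl fun m _ => by ring
    · intro m hm
      rw [hzero N m (by simpa using hm), mul_zero]
  simp only [funext hfin]
  refine tendsto_tsum_of_dominated_convergence (summable_norm_coeff_div hα s) (fun m => ?_)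
    (Eventually.of_forall fun N m => ?_)
  · simpa using (tendsto_damping (α := α) m).const_mul
      (coeff α m / (((m : ℂ) + α) * ((m : ℂ) + 1)) ^ (s + 1))
  · rw [norm_mul]
    exact mul_le_of_le_one_right (norm_nonneg _) (norm_damping_le_one hα m N)

end Analysis

end AlternatingPochhammerSum

open AlternatingPochhammerSum in
theorem stmt17 (s : ℕ) (hs : 1 ≤ s) (α : ℂ) (hα : 0 < α.re) :
    ∑' m : ℕ,
        ((Nat.factorial m : ℂ) / (ascPochhammer ℂ (m + 1)).eval α)
          * (2 * m + α + 1) * (-1 : ℂ) ^ m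
          / (((m : ℂ) + α) ^ s * ((m : ℂ) + 1) ^ s)
    = ∑' m : Fin s → ℕ, if Monotone m then
        ∏ i : Fin s, if (i : ℕ) = 0 then (1 : ℂ) / (((m i : ℂ) + α) ^ 2)
          else (1 : ℂ) / (((m i : ℂ) + α) * ((m i : ℂ) + 1))
      else 0 := by
  obtain ⟨s, rfl⟩ := Nat.exists_eq_add_of_le' hs
  have hL := tendsto_alternatingSum hα s
  rw [funext fun N => alternatingSum_eq_monotoneSum hα s N] at hL
  have h := tendsto_nhds_unique hL (tendsto_monotoneSum (summable_norm_weight hα) (s + 1))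
  simpa only [coeff, factorialRatio, weight, mul_pow] using h
end
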